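/- arXiv:cs/0411064 — 3 statements merged into one kernel-verified Lean document; each statement's English description precedes it below -/
import Mathlib

section
/- There is a universal constant C such that for every weighted connected graph G = (V,E,w) with m = |E| ≥ 2 edges and every vertex x0 ∈ V, there exists a spanning tree T of G that is a subgraph of G satisfying radius(T, x0) ≤ 2√e · radius(G, x0) and avestretch(T, E) ≤ C · (log m)^3. -/
open scoped Classical

structure WGraph (V : Type) (E : Type) where
  ends : E → V × V
  w : E → ℝ
  w_pos : ∀ e, 0 < w e

namespace WGraph

variable {V E : Type}

/-- The length of an edge is the reciprocal of its weight. -/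
noncomputable def len (G : WGraph V E) (e : E) : ℝ := 1 / G.w e

/-- A walk in a multigraph, recorded as a sequence of edge traversals. -/
inductive Walk (G : WGraph V E) : V → V → Type
  | nil (v : V) : Walk G v v
  | cons (u v x : V) (e : E)
      (h : G.ends e = (u, v) ∨ G.ends e = (v, u))
      (p : Walk G v x) : Walk G u x

/-- The length of a walk: the sum of the lengths of its edges. -/
noncomputable def Walk.length {G : WGraph V E} : ∀ {u v : V}, G.Walk u v → ℝ
  | _, _, .nil _ => 0
  | _, _, .cons _ _ _ e _ p => G.len e + Walk.length p

/-- The list of vertices visited by a walk. -/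
def Walk.support {G : WGraph V E} : ∀ {u v : V}, G.Walk u v → List V
  | _, _, .nil v => [v]
  | _, _, .cons u _ _ _ _ p => u :: Walk.support p

def Connected (G : WGraph V E) : Prop := ∀ u v : V, Nonempty (G.Walk u v)

/-- Shortest-path distance. -/
noncomputable def dist (G : WGraph V E) (u v : V) : ℝ :=
  sInf {l | ∃ p : G.Walk u v, p.length = l}

/-- Shortest-path distance inside the subgraph induced on `A`. -/
noncomputable def distOn (G : WGraph V E) (A : Set V) (u v : V) : ℝ :=
  sInf {l | ∃ p : G.Walk u v, (∀ z ∈ p.support, z ∈ A) ∧ p.length = l}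

/-- The distance from a vertex to a set of vertices. -/
noncomputable def distToSet (G : WGraph V E) (u : V) (S : Set V) : ℝ :=
  sInf {l | ∃ s ∈ S, G.dist u s = l}

/-- The distance from a vertex to a set, within the subgraph induced on `A`. -/
noncomputable def distToSetOn (G : WGraph V E) (A : Set V) (u : V) (S : Set V) : ℝ :=
  sInf {l | ∃ s ∈ S, G.distOn A u s = l}

/-- radius(G,x): the smallest `r` such that every vertex is within distance `r` of `x`. -/
noncomputable def radius (G : WGraph V E) (x : V) : ℝ :=
  sInf {r | ∀ v : V, G.dist x v ≤ r}

/-- The radius of the subgraph induced on `A`, about `x`. -/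
noncomputable def radiusOn (G : WGraph V E) (A : Set V) (x : V) : ℝ :=
  sInf {r | ∀ v ∈ A, G.distOn A x v ≤ r}

/-- The subgraph induced on `A` is connected. -/
def ConnectedOn (G : WGraph V E) (A : Set V) : Prop :=
  ∀ u ∈ A, ∀ v ∈ A, ∃ p : G.Walk u v, ∀ z ∈ p.support, z ∈ A

/-- The spanning subgraph with edge set `T`. -/
def restrictE (G : WGraph V E) (T : Set E) : WGraph V T where
  ends e := G.ends e.1
  w e := G.w e.1
  w_pos e := G.w_pos e.1

/-- `T` is the edge set of a spanning tree of `G` (a subgraph of `G`). -/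
def IsSpanningTree [Fintype V] (G : WGraph V E) (T : Finset E) : Prop :=
  (G.restrictE (T : Set E)).Connected ∧ T.card + 1 = Fintype.card V

/-- stretch_T(u,v) = dist_T(u,v)/d(u,v) for the edge e = (u,v). -/
noncomputable def stretch (G : WGraph V E) (T : Finset E) (e : E) : ℝ :=
  (G.restrictE (T : Set E)).dist (G.ends e).1 (G.ends e).2 / G.len e

/-- The average stretch over all edges. -/
noncomputable def avestretch [Fintype E] (G : WGraph V E) (T : Finset E) : ℝ :=
  (∑ e : E, G.stretch T e) / (Fintype.card E : ℝ)

/-- The Alon–Karp–Peleg–West stretch: dist_T(u,v)/dist_G(u,v). -/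
noncomputable def stretchAKPW (G : WGraph V E) (T : Finset E) (e : E) : ℝ :=
  (G.restrictE (T : Set E)).dist (G.ends e).1 (G.ends e).2 /
    G.dist (G.ends e).1 (G.ends e).2

/-- The average AKPW stretch over all edges. -/
noncomputable def avestretchAKPW [Fintype E] (G : WGraph V E) (T : Finset E) : ℝ :=
  (∑ e : E, G.stretchAKPW T e) / (Fintype.card E : ℝ)

/-- The ball of radius `r` around `x`. -/
def ball (G : WGraph V E) (r : ℝ) (x : V) : Set V := {v | G.dist x v ≤ r}

/-- The ball shell of radius `r` around `x`. -/
def ballShell (G : WGraph V E) (r : ℝ) (x : V) : Set V :=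
  {u | u ∉ G.ball r x ∧ ∃ e : E, ∃ z ∈ G.ball r x,
    (G.ends e = (u, z) ∨ G.ends e = (z, u)) ∧ G.dist x u = G.dist x z + G.len e}

/-- The set of edges with exactly one endpoint in `S`. -/
def bdry (G : WGraph V E) (S : Set V) : Set E :=
  {e | ((G.ends e).1 ∈ S ∧ (G.ends e).2 ∉ S) ∨ ((G.ends e).1 ∉ S ∧ (G.ends e).2 ∈ S)}

/-- The set of edges with both endpoints in `S`. -/
def edgesIn (G : WGraph V E) (S : Set V) : Set E :=
  {e | (G.ends e).1 ∈ S ∧ (G.ends e).2 ∈ S}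

/-- The set of edges with one endpoint in `S` and the other in `T`. -/
def edgesBetween (G : WGraph V E) (S T : Set V) : Set E :=
  {e | ((G.ends e).1 ∈ S ∧ (G.ends e).2 ∈ T) ∨ ((G.ends e).1 ∈ T ∧ (G.ends e).2 ∈ S)}

/-- vol(S): the number of edges with at least one endpoint in `S`. -/
noncomputable def volV (G : WGraph V E) (S : Set V) : ℕ :=
  {e : E | (G.ends e).1 ∈ S ∨ (G.ends e).2 ∈ S}.ncard

/-- cost(F): the sum of the weights of the edges in `F`. -/
noncomputable def cost [Fintype E] (G : WGraph V E) (F : Set E) : ℝ :=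
  ∑ e : E, F.indicator G.w e

/-- A star-decomposition of `G` with center `x0`, parts `P i`, anchors `x i`,
`y i ∈ P 0`, and bridge edges `b i` for `i ≠ 0`. -/
structure IsStarDecomp (G : WGraph V E) (x0 : V) (k : ℕ)
    (P : Fin (k + 1) → Set V) (x y : Fin (k + 1) → V)
    (b : Fin (k + 1) → E) : Prop where
  disj : ∀ i j, i ≠ j → Disjoint (P i) (P j)
  cover : ⋃ i, P i = Set.univ
  center : x0 ∈ P 0
  conn : ∀ i, G.ConnectedOn (P i)
  anchor : ∀ i, x i ∈ P i
  x0eq : x 0 = x0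
  bridge : ∀ i, i ≠ 0 → y i ∈ P 0 ∧
    (G.ends (b i) = (x i, y i) ∨ G.ends (b i) = (y i, x i))

/-- A (δ,ε)-star-decomposition. -/
def IsStarDecompDE (G : WGraph V E) (x0 : V) (δ ε : ℝ) (k : ℕ)
    (P : Fin (k + 1) → Set V) (x y : Fin (k + 1) → V)
    (b : Fin (k + 1) → E) : Prop :=
  G.IsStarDecomp x0 k P x y b ∧
  δ * G.radius x0 ≤ G.radiusOn (P 0) x0 ∧
  G.radiusOn (P 0) x0 ≤ (1 - δ) * G.radius x0 ∧
  ∀ i, i ≠ 0 →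
    G.radiusOn (P 0) x0 + G.len (b i) + G.radiusOn (P i) (x i) ≤
      (1 + ε) * G.radius x0

/-- A concentric system in `G` (indexed by nonnegative radii). -/
structure IsConcentric (G : WGraph V E) (L : ℝ → Set V) : Prop where
  nonempty : (L 0).Nonempty
  mono : ∀ r r' : ℝ, 0 ≤ r → r < r' → L r ⊆ L r'
  closed : ∀ r : ℝ, 0 ≤ r → ∀ e : E,
    ((G.ends e).1 ∈ L r → (G.ends e).2 ∈ L (r + G.len e)) ∧
    ((G.ends e).2 ∈ L r → (G.ends e).1 ∈ L (r + G.len e))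

/-- The total length of the traversals of a walk that are not forward
(with respect to `S`). -/
noncomputable def Walk.coneCost {G : WGraph V E} (S : Set V) :
    ∀ {u v : V}, G.Walk u v → ℝ
  | _, _, .nil _ => 0
  | _, _, .cons a c _ e _ p =>
      (if G.distToSet a S + G.len e = G.distToSet c S then 0 else G.len e) +
        Walk.coneCost S p

/-- The cone of width `l` around `v` induced by `S`. -/
def cone (G : WGraph V E) (S : Set V) (l : ℝ) (v : V) : Set V :=
  {u | ∃ p : G.Walk v u, Walk.coneCost S p ≤ l}

/-- `coneCost` computed within the subgraph induced on `A`. -/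
noncomputable def Walk.coneCostOn {G : WGraph V E} (A S : Set V) :
    ∀ {u v : V}, G.Walk u v → ℝ
  | _, _, .nil _ => 0
  | _, _, .cons a c _ e _ p =>
      (if G.distToSetOn A a S + G.len e = G.distToSetOn A c S then 0 else G.len e) +
        Walk.coneCostOn A S p

/-- The cone of width `l` around `v` induced by `S`, computed in the subgraph
induced on `A`. -/
def coneOn (G : WGraph V E) (A S : Set V) (l : ℝ) (v : V) : Set V :=
  {u | ∃ p : G.Walk v u, (∀ z ∈ p.support, z ∈ A) ∧ Walk.coneCostOn A S p ≤ l}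

end WGraph

namespace WGraph

section Reachability

variable {V E : Type} (G : WGraph V E)

lemma len_pos (e : E) : 0 < G.len e := one_div_pos.mpr (G.w_pos e)

/-- The edge `e` joins `a` and `c`. -/
def IsLink (e : E) (a c : V) : Prop := G.ends e = (a, c) ∨ G.ends e = (c, a)

variable {G} in
lemma IsLink.symm {e : E} {a c : V} (h : G.IsLink e a c) : G.IsLink e c a := Or.symm h

lemma isLink_ends (e : E) : G.IsLink e (G.ends e).1 (G.ends e).2 := Or.inl rfl

/-- The edges of `F` contain a walk from `a` to `c`. -/
def Joins (F : Finset E) (a c : V) : Prop :=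
  Relation.ReflTransGen (fun a c => ∃ e ∈ F, G.IsLink e a c) a c

variable {G}

lemma Joins.refl (F : Finset E) (a : V) : G.Joins F a a := Relation.ReflTransGen.refl

lemma Joins.trans {F : Finset E} {a b c : V} (h : G.Joins F a b) (h' : G.Joins F b c) :
    G.Joins F a c := Relation.ReflTransGen.trans h h'

lemma Joins.mono {F F' : Finset E} (hF : F ⊆ F') {a c : V} (h : G.Joins F a c) :
    G.Joins F' a c :=
  Relation.ReflTransGen.mono (fun _ _ ⟨e, he, h⟩ => ⟨e, hF he, h⟩) _ _ h

lemma Joins.symm {F : Finset E} {a c : V} (h : G.Joins F a c) : G.Joins F c a := by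
  induction h with
  | refl => exact Joins.refl _ _
  | tail _ h ih =>
    obtain ⟨e, he, h⟩ := h
    exact Relation.ReflTransGen.head ⟨e, he, h.symm⟩ ih

lemma Joins.of_link {F : Finset E} {e : E} (he : e ∈ F) {a c : V} (h : G.IsLink e a c) :
    G.Joins F a c := Relation.ReflTransGen.single ⟨e, he, h⟩

lemma Joins.exists_last {F : Finset E} {x u : V} (h : G.Joins F x u) (hu : u ≠ x) :
    ∃ e ∈ F, ∃ a, G.IsLink e a u ∧ G.Joins (F.erase e) x a := by
  have key : ∀ c, G.Joins F x c →
      (c ≠ u ∧ G.Joins (F.filter fun e => ∀ a, ¬ G.IsLink e a u) x c) ∨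
      ∃ e ∈ F, ∃ a, G.IsLink e a u ∧ G.Joins (F.erase e) x a := by
    intro c hc
    induction hc with
    | refl => exact Or.inl ⟨hu.symm, Joins.refl _ _⟩
    | @tail b c _ hbc ih =>
      rcases ih with ⟨hb, hj⟩ | h
      · obtain ⟨e, he, hl⟩ := hbc
        by_cases hc : c = u
        · subst hc
          refine Or.inr ⟨e, he, b, hl, hj.mono fun e' he' => ?_⟩
          rw [Finset.mem_filter] at he'
          refine Finset.mem_erase.mpr ⟨?_, he'.1⟩
          rintro rfl
          exact he'.2 _ hl
        · refine Or.inl ⟨hc, hj.trans (Joins.of_link (Finset.mem_filter.mpr ⟨he, ?_⟩) hl)⟩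
          intro a ha
          rcases hl with hl | hl <;> rcases ha with ha | ha <;> rw [hl] at ha <;>
            simp only [Prod.mk.injEq] at ha <;> tauto
      · exact Or.inr h
  rcases key u h with h | h
  · exact absurd rfl h.1
  · exact h

variable (G) in
/-- Within the edge set `S`, the vertices `a` and `c` are at `ℓ`-distance at most `r`. -/
def Reach (ℓ : E → ℝ) (S : Finset E) (a c : V) (r : ℝ) : Prop :=
  ∃ F ⊆ S, G.Joins F a c ∧ ∑ e ∈ F, ℓ e ≤ r

variable {ℓ : E → ℝ} {S S' : Finset E} {a b c : V} {r r' : ℝ}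

lemma Reach.refl (hr : 0 ≤ r) : G.Reach ℓ S a a r :=
  ⟨∅, Finset.empty_subset _, Joins.refl _ _, by simpa using hr⟩

lemma Reach.mono (h : G.Reach ℓ S a c r) (hS : S ⊆ S') (hr : r ≤ r') : G.Reach ℓ S' a c r' := by
  obtain ⟨F, hF, hj, hs⟩ := h
  exact ⟨F, hF.trans hS, hj, hs.trans hr⟩

lemma Reach.symm (h : G.Reach ℓ S a c r) : G.Reach ℓ S c a r := by
  obtain ⟨F, hF, hj, hs⟩ := h
  exact ⟨F, hF, hj.symm, hs⟩

lemma Reach.trans (hℓ : ∀ e, 0 ≤ ℓ e) (h : G.Reach ℓ S a b r) (h' : G.Reach ℓ S b c r') :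
    G.Reach ℓ S a c (r + r') := by
  obtain ⟨F, hF, hj, hs⟩ := h
  obtain ⟨F', hF', hj', hs'⟩ := h'
  refine ⟨F ∪ F', Finset.union_subset hF hF', (hj.mono Finset.subset_union_left).trans
    (hj'.mono Finset.subset_union_right), ?_⟩
  have h1 := Finset.sum_union_inter (s₁ := F) (s₂ := F') (f := ℓ)
  have h2 := Finset.sum_nonneg (s := F ∩ F') fun e _ => hℓ e
  linarith

lemma Reach.of_link {e : E} (he : e ∈ S) (h : G.IsLink e a c) : G.Reach ℓ S a c (ℓ e) :=
  ⟨{e}, by simpa using he, Joins.of_link (by simp) h, by simp⟩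

lemma Reach.nonneg (hℓ : ∀ e, 0 ≤ ℓ e) (h : G.Reach ℓ S a c r) : 0 ≤ r := by
  obtain ⟨F, -, -, hs⟩ := h
  exact (Finset.sum_nonneg fun e _ => hℓ e).trans hs

variable (G) in
/-- The edges with both ends in `A`. -/
noncomputable def inner [Fintype E] (A : Finset V) : Finset E :=
  Finset.univ.filter fun e => (G.ends e).1 ∈ A ∧ (G.ends e).2 ∈ A

lemma mem_inner [Fintype E] {A : Finset V} {e : E} :
    e ∈ G.inner A ↔ (G.ends e).1 ∈ A ∧ (G.ends e).2 ∈ A := by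
  simp [inner]

lemma IsLink.mem_inner_iff [Fintype E] {A : Finset V} {e : E} (h : G.IsLink e a c) :
    e ∈ G.inner A ↔ a ∈ A ∧ c ∈ A := by
  rw [mem_inner]
  rcases h with h | h <;> rw [h]
  tauto

lemma inner_mono [Fintype E] {A B : Finset V} (h : A ⊆ B) : G.inner A ⊆ G.inner B := by
  intro e he
  rw [mem_inner] at he ⊢
  exact ⟨h he.1, h he.2⟩

variable (G) in
/-- The `ℓ`-distance within the edge set `S`, truncated at `M`. -/
noncomputable def dst (M : ℝ) (ℓ : E → ℝ) (S : Finset E) (x u : V) : ℝ :=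
  S.powerset.inf' ⟨∅, Finset.empty_mem_powerset S⟩
    fun F => if G.Joins F x u then ∑ e ∈ F, ℓ e else M

variable {M : ℝ} {x u : V}

lemma dst_le_of_reach (h : G.Reach ℓ S x u r) : G.dst M ℓ S x u ≤ r := by
  obtain ⟨F, hF, hj, hs⟩ := h
  refine (Finset.inf'_le _ (Finset.mem_powerset.mpr hF)).trans ?_
  rwa [if_pos hj]

lemma exists_dst_eq : ∃ F ⊆ S,
    G.dst M ℓ S x u = if G.Joins F x u then ∑ e ∈ F, ℓ e else M := by
  obtain ⟨F, hF, h⟩ := Finset.exists_mem_eq_inf' ⟨∅, Finset.empty_mem_powerset S⟩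
    fun F => if G.Joins F x u then ∑ e ∈ F, ℓ e else M
  exact ⟨F, Finset.mem_powerset.mp hF, h⟩

lemma exists_of_dst_lt (h : G.dst M ℓ S x u < M) :
    ∃ F ⊆ S, G.Joins F x u ∧ ∑ e ∈ F, ℓ e = G.dst M ℓ S x u := by
  obtain ⟨F, hF, he⟩ := exists_dst_eq (G := G) (M := M) (ℓ := ℓ) (S := S) (x := x) (u := u)
  by_cases hj : G.Joins F x u
  · rw [if_pos hj] at he
    exact ⟨F, hF, hj, he.symm⟩
  · rw [if_neg hj] at he
    exact absurd he h.ne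

lemma reach_dst (h : G.dst M ℓ S x u < M) : G.Reach ℓ S x u (G.dst M ℓ S x u) := by
  obtain ⟨F, hF, hj, hs⟩ := exists_of_dst_lt h
  exact ⟨F, hF, hj, hs.le⟩

lemma dst_nonneg (hℓ : ∀ e, 0 ≤ ℓ e) (hM : 0 ≤ M) : 0 ≤ G.dst M ℓ S x u := by
  obtain ⟨F, -, h⟩ := exists_dst_eq (G := G) (M := M) (ℓ := ℓ) (S := S) (x := x) (u := u)
  rw [h]
  split_ifs
  · exact Finset.sum_nonneg fun e _ => hℓ e
  · exact hM

lemma dst_self (hℓ : ∀ e, 0 ≤ ℓ e) (hM : 0 ≤ M) : G.dst M ℓ S x x = 0 :=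
  le_antisymm (dst_le_of_reach (Reach.refl le_rfl)) (dst_nonneg hℓ hM)

lemma dst_le_bound (hM : 0 ≤ M) : G.dst M ℓ S x u ≤ M := by
  refine (Finset.inf'_le _ (Finset.empty_mem_powerset S)).trans ?_
  split_ifs
  · simpa using hM
  · exact le_rfl

lemma dst_le_add (hℓ : ∀ e, 0 ≤ ℓ e) (hM : 0 ≤ M) {e : E} (he : e ∈ S) (hl : G.IsLink e a c) :
    G.dst M ℓ S x c ≤ G.dst M ℓ S x a + ℓ e := by
  by_cases h : G.dst M ℓ S x a < M
  · exact dst_le_of_reach ((reach_dst h).trans hℓ (Reach.of_link he hl))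
  · have := dst_le_bound (G := G) (ℓ := ℓ) (S := S) (x := x) (u := c) hM
    have := hℓ e
    linarith

lemma abs_dst_sub_le (hℓ : ∀ e, 0 ≤ ℓ e) (hM : 0 ≤ M) {e : E} (he : e ∈ S)
    (hl : G.IsLink e a c) : |G.dst M ℓ S x a - G.dst M ℓ S x c| ≤ ℓ e := by
  have h1 := dst_le_add (x := x) hℓ hM he hl
  have h2 := dst_le_add (x := x) hℓ hM he hl.symm
  rw [abs_le]
  constructor <;> linarith

/-- A vertex other than the source, with an optimal edge set, has a predecessor on a shortest
path, whose optimal edge set is smaller. -/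
lemma exists_pred (hℓ : ∀ e, 0 ≤ ℓ e) (hM : 0 ≤ M) {F : Finset E} (hF : F ⊆ S)
    (hj : G.Joins F x u) (hs : ∑ e ∈ F, ℓ e = G.dst M ℓ S x u) (hu : u ≠ x) :
    ∃ e ∈ F, ∃ a, G.IsLink e a u ∧ G.dst M ℓ S x u = G.dst M ℓ S x a + ℓ e ∧
      G.Joins (F.erase e) x a ∧ ∑ e ∈ F.erase e, ℓ e = G.dst M ℓ S x a := by
  obtain ⟨e, he, a, hl, hj'⟩ := hj.exists_last hu
  have h1 : G.dst M ℓ S x a ≤ ∑ e ∈ F.erase e, ℓ e :=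
    dst_le_of_reach ⟨F.erase e, (Finset.erase_subset _ _).trans hF, hj', le_rfl⟩
  have h2 := dst_le_add (x := x) hℓ hM (hF he) hl
  have h3 := Finset.sum_erase_add F ℓ he
  exact ⟨e, he, a, hl, by linarith, hj', by linarith⟩

lemma reach_of_closed (hℓ : ∀ e, 0 ≤ ℓ e) (hM : 0 ≤ M) (P : V → Prop)
    (hP : ∀ e ∈ S, ∀ a u, G.IsLink e a u → P u →
      G.dst M ℓ S x u = G.dst M ℓ S x a + ℓ e → P a ∧ e ∈ S')
    (hu : P u) (hlt : G.dst M ℓ S x u < M) : G.Reach ℓ S' x u (G.dst M ℓ S x u) := by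
  obtain ⟨F, hF, hj, hs⟩ := exists_of_dst_lt hlt
  clear hlt
  induction hn : F.card generalizing F u with
  | zero =>
    by_cases hux : u = x
    · subst hux
      exact Reach.refl (dst_nonneg hℓ hM)
    · obtain ⟨e, he, -⟩ := exists_pred hℓ hM hF hj hs hux
      rw [Finset.card_eq_zero.mp hn] at he
      simp at he
  | succ n ih =>
    by_cases hux : u = x
    · subst hux
      exact Reach.refl (dst_nonneg hℓ hM)
    · obtain ⟨e, he, a, hl, ht, hj', hs'⟩ := exists_pred hℓ hM hF hj hs hux
      obtain ⟨ha, heS⟩ := hP e (hF he) a u hl hu ht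
      have h := ih ha (F.erase e) ((Finset.erase_subset _ _).trans hF) hj' hs'
        (by rw [Finset.card_erase_of_mem he, hn]; rfl)
      rw [ht]
      exact h.trans hℓ (Reach.of_link heS hl)

lemma exists_entry (hℓ : ∀ e, 0 ≤ ℓ e) (hM : 0 ≤ M) (P : V → Prop) (hx : ¬ P x)
    (hu : P u) (hlt : G.dst M ℓ S x u < M) :
    ∃ v, P v ∧ ∃ e ∈ S, ∃ y, ¬ P y ∧ G.IsLink e y v ∧
      G.dst M ℓ S x v = G.dst M ℓ S x y + ℓ e := by
  by_contra! hcon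
  obtain ⟨F, hF, hj, hs⟩ := exists_of_dst_lt hlt
  clear hlt
  induction hn : F.card generalizing F u with
  | zero =>
    obtain ⟨e, he, -⟩ := exists_pred hℓ hM hF hj hs (by rintro rfl; exact hx hu)
    rw [Finset.card_eq_zero.mp hn] at he
    simp at he
  | succ n ih =>
    obtain ⟨e, he, a, hl, ht, hj', hs'⟩ :=
      exists_pred hℓ hM hF hj hs (by rintro rfl; exact hx hu)
    have ha : P a := by
      by_contra ha
      exact hcon u hu e (hF he) a ha hl ht
    exact ih ha (F.erase e) ((Finset.erase_subset _ _).trans hF) hj' hs'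
      (by rw [Finset.card_erase_of_mem he, hn]; rfl)

end Reachability

section RegionGrowing

open MeasureTheory

variable {ι : Type} (S : Finset ι) (lo hi : ι → ℝ)

/-- Averaging the weight of the intervals `[lo, hi)` that contain a threshold in `(a, b)`. -/
lemma exists_threshold (c : ι → ℝ) (hc : ∀ e ∈ S, 0 ≤ c e) (hlh : ∀ e ∈ S, lo e ≤ hi e)
    {a b : ℝ} (hab : a < b) :
    ∃ r ∈ Set.Ioo a b, (b - a) * ∑ e ∈ S with (lo e ≤ r ∧ r < hi e), c e ≤
      ∑ e ∈ S with lo e ≤ b, c e * (hi e - lo e) := by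
  set f : ℝ → ℝ := fun r => ∑ e ∈ S, c e * (Set.Ico (lo e) (hi e)).indicator 1 r with hf
  have hfint : ∀ e, Integrable ((Set.Ico (lo e) (hi e)).indicator (1 : ℝ → ℝ))
      (volume.restrict (Set.Ioo a b)) := fun e =>
    (integrable_const (1 : ℝ)).indicator measurableSet_Ico
  have hfi : IntegrableOn f (Set.Ioo a b) :=
    integrable_finsetSum _ fun e _ => (hfint e).const_mul _
  obtain ⟨r, hr, hle⟩ := exists_le_setAverage (μ := volume) (s := Set.Ioo a b) (f := f)
    (by simp [hab]) (by simp) hfi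
  refine ⟨r, hr, ?_⟩
  have hfr : f r = ∑ e ∈ S with (lo e ≤ r ∧ r < hi e), c e := by
    rw [hf, Finset.sum_filter]
    refine Finset.sum_congr rfl fun e _ => ?_
    simp [Set.indicator_apply]
  have hvol : volume.real (Set.Ioo a b) = b - a := by
    rw [Real.volume_real_Ioo_of_le hab.le]
  rw [setAverage_eq, hvol, smul_eq_mul] at hle
  have hba : 0 < b - a := sub_pos.mpr hab
  have hle' : (b - a) * f r ≤ ∫ x in Set.Ioo a b, f x := by
    have := mul_le_mul_of_nonneg_left hle hba.le
    rwa [mul_inv_cancel_left₀ hba.ne'] at this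
  rw [← hfr]
  refine hle'.trans ?_
  rw [hf, integral_finsetSum _ fun e _ => (hfint e).const_mul _, Finset.sum_filter]
  refine Finset.sum_le_sum fun e he => ?_
  rw [integral_const_mul, integral_indicator_one measurableSet_Ico,
    measureReal_restrict_apply measurableSet_Ico]
  split_ifs with h
  · refine mul_le_mul_of_nonneg_left ?_ (hc e he)
    refine (measureReal_mono Set.inter_subset_left (by simp)).trans ?_
    rw [Real.volume_real_Ico_of_le (hlh e he)]
  · have : Set.Ico (lo e) (hi e) ∩ Set.Ioo a b = ∅ := by
      ext z
      simp only [Set.mem_inter_iff, Set.mem_Ico, Set.mem_Ioo, Set.mem_empty_iff_false, iff_false]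
      intro hz
      linarith [hz.1.1, hz.2.2]
    simp [this]

lemma exists_doubling (v : ℕ → ℕ) (J : ℕ) (h0 : 1 ≤ v 0) (hJ : v J < 2 ^ J) :
    ∃ j < J, v (j + 1) ≤ 2 * v j := by
  by_contra! h
  have : ∀ j ≤ J, 2 ^ j ≤ v j := by
    intro j
    induction j with
    | zero => intro; simpa using h0
    | succ j ih =>
      intro hj
      have h1 := ih (by omega)
      have h2 := h j (by omega)
      rw [pow_succ]
      omega
  exact absurd (this J le_rfl) (by omega)

/-- Region growing: some threshold in `[0, W]` has a cut whose weight is controlled by the number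
of active intervals below it. -/
lemma exists_region (act : ι → Prop) (c : ι → ℝ) (hc : ∀ e ∈ S, 0 ≤ c e)
    (hlh : ∀ e ∈ S, lo e ≤ hi e)
    (hact : ∀ e ∈ S, act e → c e * (hi e - lo e) ≤ 2) (hinact : ∀ e ∈ S, ¬ act e → c e = 0)
    {J : ℕ} (hJ : S.card < 2 ^ J) {W : ℝ} (hW : 0 < W) :
    ∃ l, 0 ≤ l ∧ l ≤ W ∧ W * ∑ e ∈ S with (lo e ≤ l ∧ l < hi e), c e ≤
      4 * J * ((S.filter fun e => act e ∧ lo e ≤ l).card : ℝ) := by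
  set v : ℝ → ℕ := fun l => (S.filter fun e => act e ∧ lo e ≤ l).card with hv
  have hvm : Monotone v := by
    intro l l' h
    refine Finset.card_le_card fun e he => ?_
    simp only [Finset.mem_filter] at he ⊢
    exact ⟨he.1, he.2.1, he.2.2.trans h⟩
  have hvS : ∀ l, v l ≤ S.card := fun l => Finset.card_filter_le _ _
  by_cases h0 : v 0 = 0
  · refine ⟨0, le_rfl, hW.le, ?_⟩
    rw [Finset.sum_eq_zero]
    · simp only [mul_zero]
      positivity
    · intro e he
      rw [Finset.mem_filter] at he
      refine hinact e he.1 fun hae => ?_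
      have : e ∈ S.filter fun e => act e ∧ lo e ≤ 0 := by
        rw [Finset.mem_filter]
        exact ⟨he.1, hae, he.2.1⟩
      rw [Finset.card_eq_zero.mp h0] at this
      simp at this
  · have hJ0 : J ≠ 0 := by
      rintro rfl
      have := hvS 0
      simp only [pow_zero, Nat.lt_one_iff] at hJ
      omega
    have hJpos : (0 : ℝ) < J := by exact_mod_cast Nat.pos_of_ne_zero hJ0
    obtain ⟨j, hj, hd⟩ := exists_doubling (fun j => v (j * (W / J))) J
      (by simpa using Nat.one_le_iff_ne_zero.mpr h0) ((hvS _).trans_lt hJ)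
    have hWJ : 0 < W / J := by positivity
    have hstep : (j : ℝ) * (W / J) < ((j + 1 : ℕ) : ℝ) * (W / J) := by
      push_cast
      nlinarith
    obtain ⟨l, ⟨hl1, hl2⟩, hle⟩ := exists_threshold S lo hi c hc hlh hstep
    have hj1 : ((j + 1 : ℕ) : ℝ) * (W / J) ≤ W := by
      have : ((j + 1 : ℕ) : ℝ) ≤ J := by exact_mod_cast hj
      calc ((j + 1 : ℕ) : ℝ) * (W / J) ≤ J * (W / J) := by gcongr
        _ = W := by field_simp
    refine ⟨l, le_trans (by positivity) hl1.le, hl2.le.trans hj1, ?_⟩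
    have hdiff : ((j + 1 : ℕ) : ℝ) * (W / J) - (j : ℝ) * (W / J) = W / J := by
      push_cast
      ring
    rw [hdiff] at hle
    have hsum : ∑ e ∈ S with lo e ≤ ((j + 1 : ℕ) : ℝ) * (W / J), c e * (hi e - lo e) ≤
        2 * (v (((j + 1 : ℕ) : ℝ) * (W / J)) : ℝ) := by
      simp only [hv, Finset.card_filter]
      push_cast
      rw [Finset.mul_sum, Finset.sum_filter]
      refine Finset.sum_le_sum fun e he => ?_
      by_cases hae : act e
      · split_ifs <;> simp_all
      · rw [hinact e he hae]
        split_ifs <;> simp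
    have hd' : (v (((j + 1 : ℕ) : ℝ) * (W / J)) : ℝ) ≤ 2 * (v l : ℝ) := by
      have : v (((j + 1 : ℕ) : ℝ) * (W / J)) ≤ 2 * v l :=
        hd.trans (Nat.mul_le_mul_left 2 (hvm hl1.le))
      exact_mod_cast this
    have hfin := hle.trans (hsum.trans (mul_le_mul_of_nonneg_left hd' zero_le_two))
    rw [div_mul_eq_mul_div, div_le_iff₀ hJpos] at hfin
    linarith

end RegionGrowing

section Cones

variable {V E : Type} [Fintype E] {G : WGraph V E}

/-- The edges inside `R` whose ends are sent by `p` to different vertices. -/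
noncomputable def cut (G : WGraph V E) (R : Finset V) (p : V → V) : Finset E :=
  (G.inner R).filter fun e => p (G.ends e).1 ≠ p (G.ends e).2

lemma mem_cut {R : Finset V} {p : V → V} {e : E} :
    e ∈ G.cut R p ↔ e ∈ G.inner R ∧ p (G.ends e).1 ≠ p (G.ends e).2 := by
  simp [cut]

/-- Vertices outside the ball of radius `r` are partitioned into cones of width at most `W`. -/
lemma exists_cones {A : Finset V} {x : V} {M W r : ℝ} {ℓ c : E → ℝ} {act : E → Prop} {J : ℕ}
    (hℓ : ∀ e, 0 ≤ ℓ e) (hc : ∀ e, 0 ≤ c e) (hact : ∀ e, act e → c e * ℓ e ≤ 1)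
    (hinact : ∀ e, ¬ act e → c e = 0) (hJ : Fintype.card E < 2 ^ J) (hW : 0 < W) (hM : 0 ≤ M)
    {f : V → ℝ} (hf : f = G.dst M ℓ (G.inner A) x) (hfM : ∀ u ∈ A, f u + W < M)
    (hfx : f x ≤ r) (n : ℕ) :
    ∀ R ⊆ A, R.card = n → (∀ u ∈ R, r < f u) →
      (∀ u ∈ R, ∀ e ∈ G.inner A, ∀ a, G.IsLink e a u → f u = f a + ℓ e → a ∈ R ∨ f a ≤ r) →
      ∃ p : V → V,
        (∀ u ∈ R, p u ∈ R ∧ p (p u) = p u ∧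
          G.Reach ℓ (G.inner (R.filter fun w => p w = p u)) (p u) u (f u - f (p u) + W)) ∧
        (∀ u ∈ R, ∃ e ∈ G.inner A, ∃ y ∈ A, f y ≤ r ∧ G.IsLink e y (p u) ∧
          f (p u) = f y + ℓ e) ∧
        (∀ e ∈ G.cut R p, 0 < ℓ e) ∧
        W * ∑ e ∈ G.cut R p, c e ≤ 4 * J * (((G.inner R).filter act).card : ℝ) := by
  induction n using Nat.strong_induction_on with
  | _ n ih =>
  intro R hRA hRn hRr hRc
  rcases R.eq_empty_or_nonempty with rfl | ⟨u₀, hu₀⟩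
  · refine ⟨id, by simp, by simp, ?_, ?_⟩ <;> simp [cut, inner]
  have hfnn : ∀ u, 0 ≤ f u := fun u => by rw [hf]; exact dst_nonneg hℓ hM
  obtain ⟨v, hv, e₀, he₀, y₀, hy₀, hl₀, ht₀⟩ := exists_entry (G := G) (S := G.inner A) (x := x)
    (u := u₀) hℓ hM (· ∈ R) (fun h => (hRr x h).not_ge hfx) hu₀
    (by have := hfM u₀ (hRA hu₀); rw [hf] at this; linarith)
  have hvA := hRA hv
  rw [← hf] at ht₀
  have hy₀r : f y₀ ≤ r := (hRc v hv e₀ he₀ y₀ hl₀ ht₀).resolve_left hy₀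
  have hy₀A : y₀ ∈ A := (hl₀.mem_inner_iff.mp he₀).1
  set d := G.dst M ℓ (G.inner R) v with hd
  set h : V → ℝ := fun u => d u + f v - f u with hh
  have hlink : ∀ e ∈ G.inner R, ∀ a b, G.IsLink e a b → |h a - h b| ≤ 2 * ℓ e := by
    intro e he a b hl
    have h1 : |d a - d b| ≤ ℓ e := abs_dst_sub_le hℓ hM he hl
    have h2 : |f a - f b| ≤ ℓ e := by
      rw [hf]
      exact abs_dst_sub_le hℓ hM (inner_mono hRA he) hl
    simp only [hh]
    rw [abs_le] at h1 h2 ⊢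
    constructor <;> linarith
  set lo : E → ℝ := fun e => min (h (G.ends e).1) (h (G.ends e).2) with hlo
  set hi : E → ℝ := fun e => max (h (G.ends e).1) (h (G.ends e).2) with hhi
  have hhl : ∀ e ∈ G.inner R, hi e - lo e ≤ 2 * ℓ e := by
    intro e he
    simp only [hlo, hhi]
    rw [max_sub_min_eq_abs']
    exact hlink e he _ _ (G.isLink_ends e)
  obtain ⟨l, hl0, hlW, hcut⟩ := exists_region (G.inner R) lo hi act c (fun e _ => hc e)
    (fun e _ => min_le_max)
    (fun e he hae => by
      have h1 := mul_le_mul_of_nonneg_left (hhl e he) (hc e)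
      have h2 := hact e hae
      linarith)
    (fun e _ => hinact e) ((Finset.card_le_univ _).trans_lt hJ) hW
  set C := R.filter fun u => h u ≤ l with hC
  set R' := R.filter fun u => ¬ h u ≤ l with hR'
  have hR'R : R' ⊆ R := Finset.filter_subset _ _
  have hvC : v ∈ C := by
    rw [hC, Finset.mem_filter]
    refine ⟨hv, ?_⟩
    have : d v = 0 := dst_self hℓ hM
    simp only [hh, this]
    linarith
  have hcard : R'.card < n := by
    rw [← hRn]
    refine Finset.card_lt_card ⟨hR'R, fun hsub => ?_⟩
    have := hsub hv
    rw [hR', Finset.mem_filter] at this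
    exact this.2 (Finset.mem_filter.mp hvC).2
  obtain ⟨p', hp1, hp2, hp3, hp4⟩ := ih R'.card hcard R' (hR'R.trans hRA) rfl
    (fun u hu => hRr u (hR'R hu)) (by
      intro u hu e he a hl ht
      rcases hRc u (hR'R hu) e he a hl ht with ha | ha
      · left
        rw [hR', Finset.mem_filter]
        refine ⟨ha, fun hal => (Finset.mem_filter.mp hu).2 ?_⟩
        have heR : e ∈ G.inner R := hl.mem_inner_iff.mpr ⟨ha, hR'R hu⟩
        have h1 : d u ≤ d a + ℓ e := dst_le_add hℓ hM heR hl
        simp only [hh] at hal ⊢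
        linarith
      · exact Or.inr ha)
  set p : V → V := fun u => if u ∈ R' then p' u else v with hp
  have hpR' : ∀ u ∈ R', p u = p' u := fun u hu => by simp only [hp, if_pos hu]
  have hpC : ∀ u, u ∉ R' → p u = v := fun u hu => by simp only [hp, if_neg hu]
  have hCR' : ∀ u ∈ R, u ∉ R' → u ∈ C := fun u hu hu' => by
    rw [hR', Finset.mem_filter] at hu'
    rw [hC, Finset.mem_filter]
    tauto
  have hCn : ∀ u ∈ C, u ∉ R' := fun u hu hu' =>
    (Finset.mem_filter.mp hu').2 (Finset.mem_filter.mp hu).2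
  have hpv : p v = v := hpC v (hCn v hvC)
  have hcutsub : G.cut R p ⊆
      (G.inner R).filter (fun e => lo e ≤ l ∧ l < hi e) ∪ G.cut R' p' := by
    intro e he
    rw [mem_cut] at he
    obtain ⟨he, hne⟩ := he
    have heR := mem_inner.mp he
    rw [Finset.mem_union, Finset.mem_filter, mem_cut]
    simp only [hlo, hhi, min_le_iff, lt_max_iff]
    by_cases h1 : (G.ends e).1 ∈ R' <;> by_cases h2 : (G.ends e).2 ∈ R'
    · right
      rw [hpR' _ h1, hpR' _ h2] at hne
      exact ⟨mem_inner.mpr ⟨h1, h2⟩, hne⟩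
    · left
      have h2' := hCR' _ heR.2 h2
      have h3 := (Finset.mem_filter.mp h1).2
      have h4 := (Finset.mem_filter.mp h2').2
      exact ⟨he, Or.inr h4, Or.inl (not_le.mp h3)⟩
    · left
      have h1' := hCR' _ heR.1 h1
      have h3 := (Finset.mem_filter.mp h2).2
      have h4 := (Finset.mem_filter.mp h1').2
      exact ⟨he, Or.inl h4, Or.inr (not_le.mp h3)⟩
    · rw [hpC _ h1, hpC _ h2] at hne
      exact absurd rfl hne
  refine ⟨p, ?_, ?_, ?_, ?_⟩
  · intro u hu
    by_cases huR : u ∈ R'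
    · obtain ⟨h1, h2, h3⟩ := hp1 u huR
      rw [hpR' u huR, hpR' _ h1]
      refine ⟨hR'R h1, h2, h3.mono (inner_mono ?_) le_rfl⟩
      intro w hw
      rw [Finset.mem_filter] at hw ⊢
      exact ⟨hR'R hw.1, by rw [hpR' w hw.1, hw.2]⟩
    · have huC := hCR' u hu huR
      rw [hpC u huR, hpv]
      refine ⟨hv, rfl, ?_⟩
      have hul : d u + f v - f u ≤ l := (Finset.mem_filter.mp huC).2
      have hlt : d u < M := by
        have := hfM u (hRA hu)
        have := hfnn v
        linarith
      have hr : G.Reach ℓ (G.inner C) v u (d u) := by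
        refine reach_of_closed hℓ hM (· ∈ C) ?_ huC hlt
        intro e he a b hl hb ht
        have hab := hl.mem_inner_iff.mp he
        have hfl : f b ≤ f a + ℓ e := by
          rw [hf]
          exact dst_le_add hℓ hM (inner_mono hRA he) hl
        have haC : a ∈ C := by
          rw [hC, Finset.mem_filter]
          refine ⟨hab.1, ?_⟩
          have hbl : d b + f v - f b ≤ l := (Finset.mem_filter.mp hb).2
          have ht' : d b = d a + ℓ e := ht
          simp only [hh]
          linarith
        exact ⟨haC, hl.mem_inner_iff.mpr ⟨haC, hb⟩⟩
      refine hr.mono (inner_mono ?_) (by linarith)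
      intro w hw
      rw [Finset.mem_filter]
      exact ⟨(Finset.mem_filter.mp hw).1, hpC w (hCn w hw)⟩
  · intro u hu
    by_cases huR : u ∈ R'
    · rw [hpR' u huR]
      exact hp2 u huR
    · rw [hpC u huR]
      exact ⟨e₀, he₀, y₀, hy₀A, hy₀r, hl₀, ht₀⟩
  · intro e he
    rcases Finset.mem_union.mp (hcutsub he) with he | he
    · rw [Finset.mem_filter] at he
      have := hhl e he.1
      linarith [he.2.1, he.2.2]
    · exact hp3 e he
  · have h1 : ∑ e ∈ G.cut R p, c e ≤
        ∑ e ∈ G.inner R with (lo e ≤ l ∧ l < hi e), c e + ∑ e ∈ G.cut R' p', c e := by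
      have h2 := Finset.sum_union_inter (f := c)
        (s₁ := (G.inner R).filter (fun e => lo e ≤ l ∧ l < hi e)) (s₂ := G.cut R' p')
      have h3 := Finset.sum_le_sum_of_subset_of_nonneg hcutsub fun e _ _ => hc e
      have h4 : 0 ≤ ∑ e ∈ (G.inner R).filter (fun e => lo e ≤ l ∧ l < hi e) ∩ G.cut R' p',
        c e := Finset.sum_nonneg fun e _ => hc e
      linarith
    have h5 : ((G.inner R).filter fun e => act e ∧ lo e ≤ l).card +
        ((G.inner R').filter act).card ≤ ((G.inner R).filter act).card := by
      rw [← Finset.card_union_of_disjoint]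
      · refine Finset.card_le_card (Finset.union_subset ?_ ?_)
        · intro e he
          rw [Finset.mem_filter] at he ⊢
          exact ⟨he.1, he.2.1⟩
        · exact Finset.filter_subset_filter _ (inner_mono hR'R)
      · rw [Finset.disjoint_left]
        intro e he he'
        rw [Finset.mem_filter] at he he'
        have h6 := mem_inner.mp he'.1
        have h7 := he.2.2
        simp only [hlo, min_le_iff] at h7
        rcases h7 with h7 | h7
        · exact (Finset.mem_filter.mp h6.1).2 h7
        · exact (Finset.mem_filter.mp h6.2).2 h7
    have h5' : (((G.inner R).filter fun e => act e ∧ lo e ≤ l).card : ℝ) +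
        ((G.inner R').filter act).card ≤ ((G.inner R).filter act).card := by exact_mod_cast h5
    have h6 := mul_le_mul_of_nonneg_left h1 hW.le
    have h7 := mul_le_mul_of_nonneg_left h5' (by positivity : (0 : ℝ) ≤ 4 * J)
    rw [mul_add] at h6 h7
    linarith

end Cones

section Star

variable {V E : Type} [Fintype E] {G : WGraph V E}

/-- A star decomposition of `A` with center `x`: the map `q` sends each vertex to the anchor of its
part, and `f` is the distance from `x` when edges shorter than `τ` are contracted. -/
lemma exists_star {A : Finset V} {x : V} {g : V → ℝ} {ρ β τ : ℝ} {J : ℕ}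
    (hρ : 0 < ρ) (hβ : 0 < β) (hβ' : β ≤ 1 / 24)
    (hτE : Fintype.card E * τ ≤ β * ρ) (hτ : 0 < τ) (hJ : Fintype.card E < 2 ^ J)
    (hg : ∀ u ∈ A, G.Reach G.len (G.inner A) x u (g u)) (hgρ : ∀ u ∈ A, g u ≤ ρ)
    (hfar : ∃ u ∈ A, ¬ G.Reach G.len (G.inner A) x u (3 / 4 * ρ)) :
    ∃ (q : V → V) (f : V → ℝ) (r : ℝ), ρ / 3 ≤ r ∧ r ≤ 2 * ρ / 3 ∧
      (∀ u ∈ A, 0 ≤ f u ∧ f u ≤ g u) ∧ q x = x ∧ (∀ u ∈ A, q u = x ∨ q u ∈ A) ∧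
      (∀ u ∈ A, q (q u) = q u) ∧ (∃ u ∈ A, q u ≠ x) ∧
      (∀ u ∈ A, q u = x → f u ≤ r ∧
        G.Reach G.len (G.inner (A.filter fun w => q w = x)) x u (f u + β * ρ)) ∧
      (∀ u ∈ A, q u ≠ x → r < f (q u) ∧
        G.Reach G.len (G.inner (A.filter fun w => q w = q u)) (q u) u
          (f u - f (q u) + 2 * (β * ρ)) ∧
        ∃ e ∈ G.inner A, ∃ y ∈ A, q y = x ∧ G.IsLink e y (q u) ∧ f (q u) = f y + G.len e) ∧
      (∀ e ∈ G.cut A q, τ ≤ G.len e) ∧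
      ρ * ∑ e ∈ G.cut A q with G.len e ≤ ρ, (G.len e)⁻¹ ≤
        (3 + 4 * J / β) *
          (((G.inner A).filter fun e => τ ≤ G.len e ∧ G.len e ≤ ρ).card : ℝ) := by
  set ℓ : E → ℝ := fun e => if G.len e < τ then 0 else G.len e with hℓdef
  have hℓ : ∀ e, 0 ≤ ℓ e := fun e => by
    simp only [hℓdef]
    split_ifs
    exacts [le_rfl, (G.len_pos e).le]
  have hℓlen : ∀ e, ℓ e ≤ G.len e := fun e => by
    simp only [hℓdef]
    split_ifs
    exacts [(G.len_pos e).le, le_rfl]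
  have hℓpos : ∀ e, 0 < ℓ e → τ ≤ G.len e ∧ ℓ e = G.len e := fun e he => by
    simp only [hℓdef] at he ⊢
    split_ifs at he ⊢ with h
    · exact absurd he (lt_irrefl 0)
    · exact ⟨not_lt.mp h, rfl⟩
  have hlenℓ : ∀ S a b t, G.Reach ℓ S a b t → G.Reach G.len S a b (t + β * ρ) := by
    rintro S a b t ⟨F, hF, hj, hs⟩
    refine ⟨F, hF, hj, ?_⟩
    have h1 : ∑ e ∈ F, G.len e ≤ ∑ e ∈ F, (ℓ e + τ) := by
      refine Finset.sum_le_sum fun e _ => ?_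
      simp only [hℓdef]
      split_ifs with h <;> linarith
    rw [Finset.sum_add_distrib, Finset.sum_const, nsmul_eq_mul] at h1
    have h2 : (F.card : ℝ) ≤ Fintype.card E := by exact_mod_cast Finset.card_le_univ F
    have h3 := mul_le_mul_of_nonneg_right h2 hτ.le
    linarith
  set act : E → Prop := fun e => τ ≤ G.len e ∧ G.len e ≤ ρ with hact
  set c : E → ℝ := fun e => if act e then (G.len e)⁻¹ else 0 with hcdef
  have hc : ∀ e, 0 ≤ c e := fun e => by
    simp only [hcdef]
    split_ifs
    exacts [(inv_pos.mpr (G.len_pos e)).le, le_rfl]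
  have hcact : ∀ e, act e → c e * ℓ e ≤ 1 := fun e he => by
    simp only [hcdef, if_pos he]
    have h := mul_le_mul_of_nonneg_left (hℓlen e) (inv_pos.mpr (G.len_pos e)).le
    rwa [inv_mul_cancel₀ (G.len_pos e).ne'] at h
  have hcin : ∀ e, ¬ act e → c e = 0 := fun e he => by simp only [hcdef, if_neg he]
  have hβρ : 0 < β * ρ := mul_pos hβ hρ
  set M : ℝ := 2 * ρ + β * ρ with hMdef
  have hM : 0 ≤ M := by positivity
  set f : V → ℝ := G.dst M ℓ (G.inner A) x with hf
  have hf0 : ∀ u, 0 ≤ f u := fun u => dst_nonneg hℓ hM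
  have hfx : f x = 0 := dst_self hℓ hM
  have hfg : ∀ u ∈ A, f u ≤ g u := fun u hu => by
    obtain ⟨F, hF, hj, hs⟩ := hg u hu
    exact dst_le_of_reach ⟨F, hF, hj, (Finset.sum_le_sum fun e _ => hℓlen e).trans hs⟩
  have hfM : ∀ u ∈ A, f u + β * ρ < M := fun u hu => by
    have := hfg u hu
    have := hgρ u hu
    linarith
  have hflip : ∀ e ∈ G.inner A, |f (G.ends e).1 - f (G.ends e).2| ≤ ℓ e := fun e he =>
    abs_dst_sub_le hℓ hM he (G.isLink_ends e)
  set lo : E → ℝ := fun e => min (f (G.ends e).1) (f (G.ends e).2) with hlo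
  set hi : E → ℝ := fun e => max (f (G.ends e).1) (f (G.ends e).2) with hhi
  have hhl : ∀ e ∈ G.inner A, hi e - lo e ≤ ℓ e := by
    intro e he
    simp only [hlo, hhi]
    rw [max_sub_min_eq_abs']
    exact hflip e he
  obtain ⟨r, ⟨hr1, hr2⟩, hball⟩ := exists_threshold (G.inner A) lo hi c (fun e _ => hc e)
    (fun e _ => min_le_max) (show ρ / 3 < 2 * ρ / 3 by linarith)
  have hballc : ∑ e ∈ G.inner A with lo e ≤ 2 * ρ / 3, c e * (hi e - lo e) ≤
      (((G.inner A).filter act).card : ℝ) := by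
    rw [Finset.card_filter]
    push_cast
    rw [Finset.sum_filter]
    refine Finset.sum_le_sum fun e he => ?_
    by_cases hae : act e
    · have h1 := mul_le_mul_of_nonneg_left (hhl e he) (hc e)
      have h2 := hcact e hae
      split_ifs <;> linarith
    · rw [hcin e hae]
      split_ifs <;> simp
  set R := A.filter fun u => ¬ f u ≤ r with hR
  have hRA : R ⊆ A := Finset.filter_subset _ _
  have hmemR : ∀ u, u ∈ R ↔ u ∈ A ∧ r < f u := fun u => by
    rw [hR, Finset.mem_filter, not_le]
  obtain ⟨p, hp1, hp2, hp3, hp4⟩ := exists_cones (x := x) hℓ hc hcact hcin hJ hβρ hM hf hfM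
    (by linarith : f x ≤ r) R.card R hRA rfl (fun u hu => ((hmemR u).mp hu).2) (by
      intro u hu e he a hl ht
      have haA := (hl.mem_inner_iff.mp he).1
      rw [hmemR]
      rcases le_or_gt (f a) r with h | h
      · exact Or.inr h
      · exact Or.inl ⟨haA, h⟩)
  have hxR : x ∉ R := fun h => by
    have := ((hmemR x).mp h).2
    linarith
  set q : V → V := fun u => if f u ≤ r then x else p u with hq
  have hqle : ∀ u, f u ≤ r → q u = x := fun u h => by simp only [hq, if_pos h]
  have hqR : ∀ u ∈ R, q u = p u := fun u h => by
    simp only [hq, if_neg (not_le.mpr ((hmemR u).mp h).2)]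
  have hqRx : ∀ u ∈ R, q u ≠ x := fun u h => by
    rw [hqR u h]
    intro he
    exact hxR (he ▸ (hp1 u h).1)
  have hqx : ∀ u ∈ A, q u = x → f u ≤ r := fun u hu h => by
    by_contra hlt
    exact hqRx u ((hmemR u).mpr ⟨hu, not_le.mp hlt⟩) h
  have hqne : ∀ u ∈ A, q u ≠ x → u ∈ R := fun u hu h => by
    rw [hmemR]
    refine ⟨hu, ?_⟩
    by_contra hle
    exact h (hqle u (not_lt.mp hle))
  have hcutsub : G.cut A q ⊆
      (G.inner A).filter (fun e => lo e ≤ r ∧ r < hi e) ∪ G.cut R p := by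
    intro e he
    obtain ⟨he, hne⟩ := mem_cut.mp he
    have heA := mem_inner.mp he
    rw [Finset.mem_union, Finset.mem_filter, mem_cut]
    simp only [hlo, hhi, min_le_iff, lt_max_iff]
    by_cases h1 : f (G.ends e).1 ≤ r <;> by_cases h2 : f (G.ends e).2 ≤ r
    · exact absurd ((hqle _ h1).trans (hqle _ h2).symm) hne
    · exact Or.inl ⟨he, Or.inl h1, Or.inr (not_le.mp h2)⟩
    · exact Or.inl ⟨he, Or.inr h2, Or.inl (not_le.mp h1)⟩
    · have h1' := (hmemR _).mpr ⟨heA.1, not_le.mp h1⟩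
      have h2' := (hmemR _).mpr ⟨heA.2, not_le.mp h2⟩
      rw [hqR _ h1', hqR _ h2'] at hne
      exact Or.inr ⟨mem_inner.mpr ⟨h1', h2'⟩, hne⟩
  refine ⟨q, f, r, hr1.le, hr2.le, fun u hu => ⟨hf0 u, hfg u hu⟩, hqle x (by linarith),
    ?_, ?_, ?_, ?_, ?_, ?_, ?_⟩
  · intro u hu
    by_cases h : q u = x
    · exact Or.inl h
    · have := hqne u hu h
      rw [hqR u this]
      exact Or.inr (hRA (hp1 u this).1)
  · intro u hu
    by_cases h : q u = x
    · rw [h]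
      exact hqle x (by linarith)
    · have := hqne u hu h
      rw [hqR u this, hqR _ (hp1 u this).1, (hp1 u this).2.1]
  · obtain ⟨u, hu, hnr⟩ := hfar
    refine ⟨u, hu, fun h => hnr ?_⟩
    have h1 := hqx u hu h
    have h2 := hfM u hu
    refine (hlenℓ _ _ _ _ (reach_dst (show f u < M by linarith))).mono subset_rfl ?_
    have h3 := mul_le_mul_of_nonneg_right hβ' hρ.le
    change f u + β * ρ ≤ _
    linarith
  · intro u hu h
    have hur := hqx u hu h
    refine ⟨hur, hlenℓ _ _ _ _ ?_⟩
    refine reach_of_closed hℓ hM (fun w => w ∈ A ∧ f w ≤ r) ?_ ⟨hu, hur⟩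
      (by have := hfM u hu; show f u < M; linarith)
    rintro e he a b hl ⟨hb, hbr⟩ ht
    have ha := (hl.mem_inner_iff.mp he).1
    have har : f a ≤ r := by
      have := hℓ e
      have ht' : f b = f a + ℓ e := ht
      linarith
    refine ⟨⟨ha, har⟩, hl.mem_inner_iff.mpr ?_⟩
    rw [Finset.mem_filter, Finset.mem_filter]
    exact ⟨⟨ha, hqle a har⟩, hb, hqle b hbr⟩
  · intro u hu h
    have huR := hqne u hu h
    obtain ⟨h1, -, h3⟩ := hp1 u huR
    obtain ⟨e, he, y, hy, hyr, hl, ht⟩ := hp2 u huR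
    have hpr := ((hmemR _).mp h1).2
    rw [hqR u huR]
    refine ⟨hpr, ?_, e, he, y, hy, hqle y hyr, hl, ?_⟩
    · refine (hlenℓ _ _ _ _ h3).mono (inner_mono ?_) (by linarith)
      intro w hw
      rw [Finset.mem_filter] at hw ⊢
      exact ⟨hRA hw.1, by rw [hqR w hw.1, hw.2]⟩
    · rw [← (hℓpos e (by linarith)).2, ht]
  · intro e he
    rcases Finset.mem_union.mp (hcutsub he) with he | he
    · rw [Finset.mem_filter] at he
      have := hhl e he.1
      exact (hℓpos e (by linarith [he.2.1, he.2.2])).1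
    · exact (hℓpos e (hp3 e he)).1
  · have h1 : ∑ e ∈ G.cut A q with G.len e ≤ ρ, (G.len e)⁻¹ ≤ ∑ e ∈ G.cut A q, c e := by
      rw [Finset.sum_filter]
      refine Finset.sum_le_sum fun e he => ?_
      split_ifs with h
      · have hae : act e := by
          refine ⟨?_, h⟩
          rcases Finset.mem_union.mp (hcutsub he) with he | he
          · rw [Finset.mem_filter] at he
            have := hhl e he.1
            exact (hℓpos e (by linarith [he.2.1, he.2.2])).1
          · exact (hℓpos e (hp3 e he)).1
        simp only [hcdef, if_pos hae]
        exact le_rfl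
      · exact hc e
    have h2 : ∑ e ∈ G.cut A q, c e ≤
        ∑ e ∈ G.inner A with (lo e ≤ r ∧ r < hi e), c e + ∑ e ∈ G.cut R p, c e := by
      have h2 := Finset.sum_union_inter (f := c)
        (s₁ := (G.inner A).filter (fun e => lo e ≤ r ∧ r < hi e)) (s₂ := G.cut R p)
      have h3 := Finset.sum_le_sum_of_subset_of_nonneg hcutsub fun e _ _ => hc e
      have h4 : 0 ≤ ∑ e ∈ (G.inner A).filter (fun e => lo e ≤ r ∧ r < hi e) ∩ G.cut R p,
        c e := Finset.sum_nonneg fun e _ => hc e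
      linarith
    have h3 : (((G.inner R).filter act).card : ℝ) ≤ ((G.inner A).filter act).card := by
      exact_mod_cast Finset.card_le_card (Finset.filter_subset_filter _ (inner_mono hRA))
    have h4 : ρ * ∑ e ∈ G.inner A with (lo e ≤ r ∧ r < hi e), c e ≤
        3 * ((G.inner A).filter act).card := by linarith
    have h5 : ρ * ∑ e ∈ G.cut R p, c e ≤ 4 * J / β * ((G.inner A).filter act).card := by
      have h6 : β * ρ * ∑ e ∈ G.cut R p, c e ≤ 4 * J * (((G.inner R).filter act).card : ℝ) := by
        convert hp4
      replace h6 := h6.trans (mul_le_mul_of_nonneg_left h3 (by positivity : (0 : ℝ) ≤ 4 * J))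
      rw [div_mul_eq_mul_div, le_div_iff₀ hβ]
      linarith
    have h6 := mul_le_mul_of_nonneg_left (h1.trans h2) hρ.le
    rw [mul_add] at h6
    change _ ≤ (3 + 4 * J / β) * (((G.inner A).filter act).card : ℝ)
    linarith

end Star

section Tree

open Real

/-- The potential paid by an edge of length `ρ / t` in a piece of radius `ρ`. -/
noncomputable def potential (Y t : ℝ) : ℝ := 1 + 4 * log (max 1 (4 / 3 * min t Y))

lemma one_le_potential (Y t : ℝ) : 1 ≤ potential Y t := by
  have := log_nonneg (le_max_left 1 (4 / 3 * min t Y))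
  unfold potential
  linarith

lemma potential_mono (Y : ℝ) : Monotone (potential Y) := by
  intro t t' h
  unfold potential
  gcongr

lemma potential_le {Y : ℝ} (hY : 1 ≤ Y) (t : ℝ) : potential Y t ≤ 1 + 4 * log (4 / 3 * Y) := by
  unfold potential
  gcongr
  refine max_le (by linarith) ?_
  have := min_le_right t Y
  linarith

lemma one_div_four_le_log : 1 / 4 ≤ log (4 / 3) := by
  have := one_sub_inv_le_log_of_pos (show (0 : ℝ) < 4 / 3 by norm_num)
  norm_num at this ⊢
  linarith

lemma potential_step {Y t : ℝ} (h1 : 1 ≤ t) (hY : t ≤ Y) :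
    potential Y (3 / 4 * t) + 1 ≤ potential Y t := by
  have e1 : max 1 (4 / 3 * min t Y) = 4 / 3 * t := by
    rw [min_eq_left hY, max_eq_right]
    linarith
  have e2 : max 1 (4 / 3 * min (3 / 4 * t) Y) = t := by
    rw [min_eq_left (by linarith), max_eq_right] <;> linarith
  unfold potential
  rw [e1, e2, log_mul (by norm_num) (by linarith)]
  have := one_div_four_le_log
  linarith

/-- The excess of the tree distance over the graph distance in a piece of radius `ρ`. -/
noncomputable def excess (γ δ ρ : ℝ) : ℝ := ρ * ((max 1 (ρ / δ)) ^ γ - 1)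

lemma excess_nonneg {γ δ ρ : ℝ} (hγ : 0 ≤ γ) (hρ : 0 ≤ ρ) : 0 ≤ excess γ δ ρ :=
  mul_nonneg hρ (sub_nonneg.mpr (one_le_rpow (le_max_left _ _) hγ))

lemma excess_mono {γ δ ρ ρ' : ℝ} (hγ : 0 ≤ γ) (hδ : 0 < δ) (hρ : 0 ≤ ρ) (h : ρ ≤ ρ') :
    excess γ δ ρ ≤ excess γ δ ρ' := by
  unfold excess
  have h1 : (1 : ℝ) ≤ (max 1 (ρ / δ)) ^ γ := one_le_rpow (le_max_left _ _) hγ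
  gcongr
  linarith

lemma excess_step {γ δ ρ a b ε : ℝ} (hγ : 0 ≤ γ) (hδ : 0 < δ) (ha : 0 ≤ a) (hb : 0 ≤ b)
    (ha' : a ≤ 3 / 4 * ρ) (hb' : b ≤ 3 / 4 * ρ) (hab : a + b ≤ (1 + ε) * ρ)
    (hε : (1 + ε) * (3 / 4 : ℝ) ^ γ ≤ 1) (hρ : 4 / 3 * δ ≤ ρ) :
    ε * ρ + excess γ δ a + excess γ δ b ≤ excess γ δ ρ := by
  have hρ0 : 0 < ρ := by linarith
  have hz : 1 ≤ 3 / 4 * (ρ / δ) := by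
    rw [← mul_div_assoc, le_div_iff₀ hδ]
    linarith
  set Z := (3 / 4 * (ρ / δ)) ^ γ with hZ
  have hZ1 : 1 ≤ Z := one_le_rpow hz hγ
  have key : ∀ t, 0 ≤ t → t ≤ 3 / 4 * ρ → excess γ δ t ≤ t * (Z - 1) := by
    intro t ht ht'
    unfold excess
    have : max 1 (t / δ) ≤ 3 / 4 * (ρ / δ) := by
      refine max_le hz ?_
      rw [← mul_div_assoc]
      gcongr
    have : max 1 (t / δ) ^ γ ≤ Z :=
      rpow_le_rpow (zero_le_one.trans (le_max_left _ _)) this hγ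
    gcongr
  have h1 := key a ha ha'
  have h2 := key b hb hb'
  have h3 : (a + b) * (Z - 1) ≤ (1 + ε) * ρ * (Z - 1) :=
    mul_le_mul_of_nonneg_right hab (by linarith)
  have h4 : Z = (3 / 4 : ℝ) ^ γ * (ρ / δ) ^ γ := mul_rpow (by norm_num) (by positivity)
  have h5 : (1 + ε) * Z ≤ (ρ / δ) ^ γ := by
    rw [h4, ← mul_assoc]
    have : 0 ≤ (ρ / δ) ^ γ := by positivity
    nlinarith
  have h6 : excess γ δ ρ = ρ * ((ρ / δ) ^ γ - 1) := by
    unfold excess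
    rw [max_eq_right (by linarith)]
  rw [h6]
  nlinarith

variable {V E : Type} [Fintype E]

/-- The piece `A` with center `x` has a tree of small stretch in which the distance from `x` to
each vertex `u` exceeds `g u` by a controlled amount. -/
def HasTree (G : WGraph V E) (γ Q Y : ℝ) (A : Finset V) (x : V) (g : V → ℝ) (ρ : ℝ) : Prop :=
  ∃ (T : Finset E) (s : E → ℝ), T.card + 1 ≤ A.card ∧ (∀ e ∈ T, G.len e ≤ ρ) ∧
    (∀ δ, 0 < δ → ∀ u ∈ A, G.Reach G.len T x u (g u + excess γ δ ρ + 2 * δ * A.card)) ∧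
    (∀ e ∈ G.inner A, G.Reach G.len T (G.ends e).1 (G.ends e).2 (s e)) ∧
    ∑ e ∈ G.inner A, s e / G.len e ≤ Q * ∑ e ∈ G.inner A, potential Y (ρ / G.len e)

variable {G : WGraph V E} {γ Q Y : ℝ} {A : Finset V} {x : V} {g : V → ℝ} {ρ : ℝ}

lemma HasTree.mono (hγ : 0 ≤ γ) (hQ : 0 ≤ Q) {g' : V → ℝ} {ρ' : ℝ} (hρ : 0 ≤ ρ)
    (hg : ∀ u ∈ A, g u ≤ g' u) (hρ' : ρ ≤ ρ') (h : G.HasTree γ Q Y A x g ρ) :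
    G.HasTree γ Q Y A x g' ρ' := by
  obtain ⟨T, s, h1, h2, h3, h4, h5⟩ := h
  refine ⟨T, s, h1, fun e he => (h2 e he).trans hρ', fun δ hδ u hu => ?_, h4, h5.trans ?_⟩
  · have := excess_mono hγ hδ hρ hρ'
    have := hg u hu
    exact (h3 δ hδ u hu).mono subset_rfl (by linarith)
  · refine mul_le_mul_of_nonneg_left (Finset.sum_le_sum fun e _ => potential_mono Y ?_) hQ
    have := G.len_pos e
    gcongr

lemma hasTree_singleton (hγ : 0 ≤ γ) (hQ : 0 ≤ Q) (hg : 0 ≤ g x) (hρ : 0 ≤ ρ) :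
    G.HasTree γ Q Y {x} x g ρ := by
  refine ⟨∅, 0, by simp, by simp, fun δ hδ u hu => ?_, fun e he => ?_, ?_⟩
  · rw [Finset.mem_singleton] at hu
    subst hu
    have := excess_nonneg (δ := δ) hγ hρ
    exact Reach.refl (by positivity)
  · have := mem_inner.mp he
    simp only [Finset.mem_singleton] at this
    rw [this.1, this.2]
    exact Reach.refl le_rfl
  · simp only [Pi.zero_apply, zero_div, Finset.sum_const_zero]
    exact mul_nonneg hQ (Finset.sum_nonneg fun e _ => zero_le_one.trans (one_le_potential _ _))

lemma sum_inner_filter_eq (A : Finset V) (q : V → V) (φ : V → E → ℝ) :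
    ∑ v ∈ A.image q, ∑ e ∈ G.inner (A.filter fun w => q w = v), φ v e =
      ∑ e ∈ G.inner A with q (G.ends e).1 = q (G.ends e).2, φ (q (G.ends e).1) e := by
  rw [← Finset.sum_fiberwise_of_maps_to (t := A.image q) (g := fun e => q (G.ends e).1)]
  · refine Finset.sum_congr rfl fun v _ => ?_
    have : G.inner (A.filter fun w => q w = v) = ((G.inner A).filter fun e =>
        q (G.ends e).1 = q (G.ends e).2).filter fun e => q (G.ends e).1 = v := by
      ext e
      simp only [mem_inner, Finset.mem_filter]
      constructor
      · rintro ⟨⟨h1, h2⟩, h3, h4⟩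
        exact ⟨⟨⟨h1, h3⟩, h2.trans h4.symm⟩, h2⟩
      · rintro ⟨⟨⟨h1, h3⟩, h5⟩, h2⟩
        exact ⟨⟨h1, h2⟩, h3, h5.symm.trans h2⟩
    rw [this]
    refine Finset.sum_congr rfl fun e he => ?_
    rw [(Finset.mem_filter.mp he).2]
  · intro e he
    rw [Finset.mem_filter, mem_inner] at he
    exact Finset.mem_image_of_mem q he.1.1

/-- The stretch bound for a piece, from those of its parts. -/
lemma sum_stretch_le {q : V → V} {s : E → ℝ} {t : V → E → ℝ} {b : V → ℝ} {ρ τ κ : ℝ}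
    (hρ : 0 < ρ) (hτ : 0 < τ) (hτY : ρ / τ ≤ Y) (hκ : 1 ≤ κ) (hQ : 6 * κ ≤ Q)
    (hb : ∀ v ∈ A.image q, b v ≤ 3 / 4 * ρ)
    (ht : ∀ v ∈ A.image q, ∑ e ∈ G.inner (A.filter fun w => q w = v), t v e / G.len e ≤
      Q * ∑ e ∈ G.inner (A.filter fun w => q w = v), potential Y (b v / G.len e))
    (hs : s = fun e => if q (G.ends e).1 = q (G.ends e).2 then t (q (G.ends e).1) e else 6 * ρ)
    (hcut : ∀ e ∈ G.cut A q, τ ≤ G.len e)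
    (hsum : ρ * ∑ e ∈ G.cut A q with G.len e ≤ ρ, (G.len e)⁻¹ ≤
        κ * (((G.inner A).filter fun e => τ ≤ G.len e ∧ G.len e ≤ ρ).card : ℝ)) :
    ∑ e ∈ G.inner A, s e / G.len e ≤ Q * ∑ e ∈ G.inner A, potential Y (ρ / G.len e) := by
  have hQ0 : 0 ≤ Q := by linarith
  rw [← Finset.sum_filter_add_sum_filter_not (G.inner A)
    (fun e => q (G.ends e).1 = q (G.ends e).2)]
  have h1 : ∑ e ∈ G.inner A with q (G.ends e).1 = q (G.ends e).2, s e / G.len e ≤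
      Q * ∑ e ∈ G.inner A with q (G.ends e).1 = q (G.ends e).2,
        potential Y (3 / 4 * (ρ / G.len e)) := by
    calc _ = ∑ e ∈ G.inner A with q (G.ends e).1 = q (G.ends e).2,
          t (q (G.ends e).1) e / G.len e := by
          refine Finset.sum_congr rfl fun e he => ?_
          rw [hs]
          simp only [if_pos (Finset.mem_filter.mp he).2]
      _ = ∑ v ∈ A.image q, ∑ e ∈ G.inner (A.filter fun w => q w = v), t v e / G.len e :=
          (sum_inner_filter_eq A q fun v e => t v e / G.len e).symm
      _ ≤ ∑ v ∈ A.image q, Q * ∑ e ∈ G.inner (A.filter fun w => q w = v),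
          potential Y (3 / 4 * (ρ / G.len e)) := by
          refine Finset.sum_le_sum fun v hv => (ht v hv).trans ?_
          refine mul_le_mul_of_nonneg_left (Finset.sum_le_sum fun e _ => potential_mono Y ?_) hQ0
          have := G.len_pos e
          have := hb v hv
          rw [← mul_div_assoc]
          gcongr
      _ = _ := by
          rw [← Finset.mul_sum,
            sum_inner_filter_eq A q fun _ e => potential Y (3 / 4 * (ρ / G.len e))]
  have h2 : ∑ e ∈ G.inner A with ¬ q (G.ends e).1 = q (G.ends e).2, s e / G.len e ≤
      Q * ((((G.inner A).filter fun e => τ ≤ G.len e ∧ G.len e ≤ ρ).card : ℝ) +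
        (((G.cut A q).filter fun e => ¬ G.len e ≤ ρ).card : ℝ)) := by
    change ∑ e ∈ G.cut A q, s e / G.len e ≤ _
    rw [← Finset.sum_filter_add_sum_filter_not (G.cut A q) (fun e => G.len e ≤ ρ), mul_add]
    have hse : ∀ e ∈ G.cut A q, s e = 6 * ρ := fun e he => by
      rw [hs]
      simp only [if_neg (mem_cut.mp he).2]
    refine add_le_add ?_ ?_
    · calc _ = 6 * (ρ * ∑ e ∈ G.cut A q with G.len e ≤ ρ, (G.len e)⁻¹) := by
            rw [Finset.mul_sum, Finset.mul_sum]
            refine Finset.sum_congr rfl fun e he => ?_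
            rw [hse e (Finset.mem_filter.mp he).1, div_eq_mul_inv, mul_assoc]
        _ ≤ 6 * (κ * _) := mul_le_mul_of_nonneg_left hsum (by norm_num)
        _ ≤ _ := by
            rw [← mul_assoc]
            exact mul_le_mul_of_nonneg_right hQ (Nat.cast_nonneg _)
    · rw [Finset.card_eq_sum_ones]
      push_cast
      rw [Finset.mul_sum]
      refine Finset.sum_le_sum fun e he => ?_
      rw [Finset.mem_filter, not_le] at he
      rw [hse e he.1, div_le_iff₀ (G.len_pos e)]
      have := he.2
      nlinarith
  have h3 : ∑ e ∈ G.inner A with q (G.ends e).1 = q (G.ends e).2,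
        potential Y (3 / 4 * (ρ / G.len e)) +
      ((((G.inner A).filter fun e => τ ≤ G.len e ∧ G.len e ≤ ρ).card : ℝ) +
        (((G.cut A q).filter fun e => ¬ G.len e ≤ ρ).card : ℝ)) ≤
      ∑ e ∈ G.inner A, potential Y (ρ / G.len e) := by
    rw [cut, Finset.filter_filter, Finset.card_filter, Finset.card_filter]
    push_cast
    rw [Finset.sum_filter, ← Finset.sum_add_distrib, ← Finset.sum_add_distrib]
    refine Finset.sum_le_sum fun e he => ?_
    have hl := G.len_pos e
    have hp1 := one_le_potential Y (ρ / G.len e)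
    have hmono : potential Y (3 / 4 * (ρ / G.len e)) ≤ potential Y (ρ / G.len e) := by
      refine potential_mono Y ?_
      have : 0 < ρ / G.len e := by positivity
      linarith
    have hstep : τ ≤ G.len e ∧ G.len e ≤ ρ →
        potential Y (3 / 4 * (ρ / G.len e)) + 1 ≤ potential Y (ρ / G.len e) := by
      rintro ⟨h1, h2⟩
      refine potential_step ((one_le_div hl).mpr h2) (le_trans ?_ hτY)
      gcongr
    by_cases hq : q (G.ends e).1 = q (G.ends e).2 <;>
      by_cases ha : τ ≤ G.len e ∧ G.len e ≤ ρ
    · have := hstep ha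
      simp [hq, ha]
      linarith
    · simp [hq, ha]
      linarith
    · simp [hq, ha]
      linarith
    · have hlt : ρ < G.len e := by
        by_contra h
        exact ha ⟨hcut e (mem_cut.mpr ⟨he, hq⟩), not_lt.mp h⟩
      simp [hq, hlt.not_ge]
      linarith
  have h4 := mul_le_mul_of_nonneg_left h3 hQ0
  rw [mul_add] at h4
  linarith

end Tree

section Assembly

open Real

variable {V E : Type} [Fintype E] {G : WGraph V E} {γ Q Y : ℝ} {A : Finset V} {x : V} {ρ : ℝ}

/-- Trees of the parts of a star decomposition, joined by its bridges, form a tree of the whole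
piece. -/
lemma hasTree_of_star {f g : V → ℝ} {q : V → V} {r β τ κ D : ℝ}
    (hβ : 0 < β) (hβ' : β ≤ 1 / 24) (hγ : 0 ≤ γ) (hγβ : (1 + 3 * β) * (3 / 4 : ℝ) ^ γ ≤ 1)
    (hD : 2 * A.card ≤ D) (hDγ : D ^ γ ≤ 2) (hρ : 0 < ρ) (hx : x ∈ A)
    (hτ : 0 < τ) (hτY : ρ / τ ≤ Y) (hκ : 1 ≤ κ) (hQ : 6 * κ ≤ Q)
    (hr : ρ / 3 ≤ r) (hr' : r ≤ 2 * ρ / 3) (hgρ : ∀ u ∈ A, g u ≤ ρ)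
    (hf : ∀ u ∈ A, 0 ≤ f u ∧ f u ≤ g u) (hqx : q x = x)
    (hqA : ∀ u ∈ A, q u = x ∨ q u ∈ A) (hqq : ∀ u ∈ A, q (q u) = q u) (hne : ∃ u ∈ A, q u ≠ x)
    (hbridge : ∀ u ∈ A, q u ≠ x → ∃ e ∈ G.inner A, ∃ y ∈ A, q y = x ∧ G.IsLink e y (q u) ∧
      f (q u) = f y + G.len e)
    (hcut : ∀ e ∈ G.cut A q, τ ≤ G.len e)
    (hsum : ρ * ∑ e ∈ G.cut A q with G.len e ≤ ρ, (G.len e)⁻¹ ≤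
      κ * (((G.inner A).filter fun e => τ ≤ G.len e ∧ G.len e ≤ ρ).card : ℝ))
    (hpart : ∀ v ∈ A.image q, G.HasTree γ Q Y (A.filter fun w => q w = v) v
      (fun u => if v = x then f u + β * ρ else f u - f v + 2 * (β * ρ))
      (if v = x then r + β * ρ else ρ - r + 2 * (β * ρ))) :
    G.HasTree γ Q Y A x g ρ := by
  have hlen : ∀ e, 0 ≤ G.len e := fun e => (G.len_pos e).le
  have hβρ : 0 < β * ρ := mul_pos hβ hρ
  have hβρ' : β * ρ ≤ 1 / 24 * ρ := mul_le_mul_of_nonneg_right hβ' hρ.le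
  have hA1 : 1 ≤ A.card := Finset.card_pos.mpr ⟨x, hx⟩
  have hA1' : (1 : ℝ) ≤ A.card := by exact_mod_cast hA1
  obtain ⟨u₀, hu₀, hu₀x⟩ := hne
  have : Nonempty V := ⟨x⟩
  have : Nonempty E := ⟨(hbridge u₀ hu₀ hu₀x).choose⟩
  have hxI : x ∈ A.image q := Finset.mem_image.mpr ⟨x, hx, hqx⟩
  have hIq : ∀ v ∈ A.image q, v ∈ A ∧ q v = v := by
    intro v hv
    obtain ⟨u, hu, rfl⟩ := Finset.mem_image.mp hv
    refine ⟨?_, hqq u hu⟩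
    rcases hqA u hu with h | h
    · rwa [h]
    · exact h
  have hbr : ∀ v ∈ (A.image q).erase x, ∃ e y, y ∈ A ∧ q y = x ∧ G.IsLink e y v ∧
      f v = f y + G.len e := by
    intro v hv
    obtain ⟨hvx, hv⟩ := Finset.mem_erase.mp hv
    obtain ⟨u, hu, rfl⟩ := Finset.mem_image.mp hv
    obtain ⟨e, -, y, h⟩ := hbridge u hu hvx
    exact ⟨e, y, h⟩
  choose! br y hyA hqy hlink hfy using hbr
  choose! T t hTc hTlen hTd hTt hTs using hpart
  set T' : Finset E := (A.image q).biUnion T ∪ ((A.image q).erase x).image br with hT'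
  have hsub : ∀ v ∈ A.image q, T v ⊆ T' := fun v hv =>
    (Finset.subset_biUnion_of_mem T hv).trans Finset.subset_union_left
  have hbrT : ∀ v ∈ (A.image q).erase x, br v ∈ T' := fun v hv =>
    Finset.mem_union_right _ (Finset.mem_image_of_mem br hv)
  have hcard : T'.card + 1 ≤ A.card := by
    have h1 : T'.card ≤ ∑ v ∈ A.image q, (T v).card + ((A.image q).card - 1) := by
      rw [← Finset.card_erase_of_mem hxI]
      exact (Finset.card_union_le _ _).trans
        (add_le_add Finset.card_biUnion_le Finset.card_image_le)
    have h2 : ∑ v ∈ A.image q, ((T v).card + 1) ≤ A.card := by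
      rw [Finset.card_eq_sum_card_image q A]
      exact Finset.sum_le_sum hTc
    rw [Finset.sum_add_distrib, ← Finset.card_eq_sum_ones] at h2
    have h3 : 0 < (A.image q).card := Finset.card_pos.mpr ⟨x, hxI⟩
    omega
  have hb : ∀ v, (if v = x then r + β * ρ else ρ - r + 2 * (β * ρ)) ≤ 3 / 4 * ρ := by
    intro v
    split_ifs <;> linarith
  have hlenT : ∀ e ∈ T', G.len e ≤ ρ := by
    intro e he
    rcases Finset.mem_union.mp he with he | he
    · obtain ⟨v, hv, he⟩ := Finset.mem_biUnion.mp he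
      have := hTlen v hv e he
      have := hb v
      linarith
    · obtain ⟨v, hv, rfl⟩ := Finset.mem_image.mp he
      have h1 := hIq v (Finset.mem_of_mem_erase hv)
      have h2 := hfy v hv
      have h3 := (hf _ (hyA v hv)).1
      have h4 := (hf v h1.1).2
      have h5 := hgρ v h1.1
      linarith
  have hpath : ∀ δ, 0 < δ → ∀ u ∈ A, G.Reach G.len T' x u (f u + 3 * β * ρ +
      excess γ δ (r + β * ρ) + excess γ δ (ρ - r + 2 * (β * ρ)) + 2 * δ * A.card) := by
    intro δ hδ u hu
    have he1 := excess_nonneg (γ := γ) (δ := δ) (ρ := r + β * ρ) hγ (by linarith)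
    have he2 := excess_nonneg (γ := γ) (δ := δ) (ρ := ρ - r + 2 * (β * ρ)) hγ (by linarith)
    have hroot : ∀ u ∈ A, q u = x → G.Reach G.len T' x u (f u + β * ρ +
        excess γ δ (r + β * ρ) + 2 * δ * (A.filter fun w => q w = x).card) := by
      intro u hu hux
      have := hTd x hxI δ hδ u (Finset.mem_filter.mpr ⟨hu, hux⟩)
      simp only [if_true] at this
      exact this.mono (hsub x hxI) le_rfl
    by_cases hux : q u = x
    · refine (hroot u hu hux).mono subset_rfl ?_
      have : ((A.filter fun w => q w = x).card : ℝ) ≤ A.card := by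
        exact_mod_cast Finset.card_filter_le _ _
      have : 2 * δ * ((A.filter fun w => q w = x).card : ℝ) ≤ 2 * δ * A.card := by gcongr
      linarith
    · have hvI : q u ∈ A.image q := Finset.mem_image_of_mem q hu
      have hv : q u ∈ (A.image q).erase x := Finset.mem_erase.mpr ⟨hux, hvI⟩
      have h1 := hroot _ (hyA _ hv) (hqy _ hv)
      have h2 := Reach.of_link (ℓ := G.len) (hbrT _ hv) (hlink _ hv)
      have h3 := (hTd _ hvI δ hδ u (Finset.mem_filter.mpr ⟨hu, rfl⟩)).mono (hsub _ hvI) le_rfl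
      simp only [if_neg hux] at h3
      refine ((h1.trans hlen h2).trans hlen h3).mono subset_rfl ?_
      have h4 : (A.filter fun w => q w = x).card + (A.filter fun w => q w = q u).card ≤
          A.card := by
        rw [← Finset.card_union_of_disjoint]
        · exact Finset.card_le_card
            (Finset.union_subset (Finset.filter_subset _ _) (Finset.filter_subset _ _))
        · refine Finset.disjoint_filter.mpr fun w _ hw hw' => hux ?_
          rw [← hw', hw]
      have h5 : ((A.filter fun w => q w = x).card : ℝ) + (A.filter fun w => q w = q u).card ≤
          A.card := by exact_mod_cast h4
      have h6 := mul_le_mul_of_nonneg_left h5 (show 0 ≤ 2 * δ by linarith)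
      have h7 := hfy _ hv
      rw [mul_add] at h6
      linarith
  have hdist : ∀ δ, 0 < δ → ∀ u ∈ A,
      G.Reach G.len T' x u (g u + excess γ δ ρ + 2 * δ * A.card) := by
    intro δ hδ u hu
    have hfu := hf u hu
    by_cases hδρ : 4 / 3 * δ ≤ ρ
    · refine (hpath δ hδ u hu).mono subset_rfl ?_
      have := excess_step (a := r + β * ρ) (b := ρ - r + 2 * (β * ρ)) hγ hδ (by linarith)
        (by linarith) (by linarith) (by linarith) (by linarith) hγβ hδρ
      linarith
    · obtain ⟨F, hF, hj, -⟩ := hpath δ hδ u hu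
      refine ⟨F, hF, hj, ?_⟩
      have he := excess_nonneg (γ := γ) (δ := δ) hγ hρ.le
      have h1 : ∑ e ∈ F, G.len e ≤ F.card * ρ := by
        rw [← nsmul_eq_mul]
        exact Finset.sum_le_card_nsmul _ _ _ fun e he => hlenT e (hF he)
      have h2 : (F.card : ℝ) ≤ A.card := by
        have := Finset.card_le_card hF
        exact_mod_cast (by omega : F.card ≤ A.card)
      have h3 : (F.card : ℝ) * ρ ≤ A.card * (2 * δ) :=
        mul_le_mul h2 (by linarith) hρ.le (by positivity)
      linarith
  have hlong : ∀ u ∈ A, G.Reach G.len T' x u (3 * ρ) := by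
    intro u hu
    have hD0 : 0 < D := by linarith
    refine (hdist (ρ / D) (by positivity) u hu).mono subset_rfl ?_
    have h1 : excess γ (ρ / D) ρ ≤ ρ := by
      unfold excess
      rw [div_div_cancel₀ hρ.ne', max_eq_right (by linarith)]
      nlinarith
    have h2 : 2 * (ρ / D) * A.card ≤ ρ := by
      rw [show 2 * (ρ / D) * A.card = ρ * (2 * A.card) / D by ring, div_le_iff₀ hD0]
      gcongr
    have := hgρ u hu
    linarith
  refine ⟨T', fun e => if q (G.ends e).1 = q (G.ends e).2 then t (q (G.ends e).1) e else 6 * ρ,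
    hcard, hlenT, hdist, fun e he => ?_,
    sum_stretch_le hρ hτ hτY hκ hQ (fun v _ => hb v) hTs rfl hcut hsum⟩
  rw [mem_inner] at he
  dsimp only
  split_ifs with hq
  · have hvI : q (G.ends e).1 ∈ A.image q := Finset.mem_image_of_mem q he.1
    refine (hTt _ hvI e ?_).mono (hsub _ hvI) le_rfl
    rw [mem_inner, Finset.mem_filter, Finset.mem_filter]
    exact ⟨⟨he.1, rfl⟩, he.2, hq.symm⟩
  · refine ((hlong _ he.1).symm.trans hlen (hlong _ he.2)).mono subset_rfl ?_
    linarith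

/-- Every connected piece has a tree of small stretch. -/
theorem hasTree {β D : ℝ} {J : ℕ} (hE : 0 < Fintype.card E) (hβ : 0 < β) (hβ' : β ≤ 1 / 24)
    (hγ : 0 ≤ γ) (hγβ : (1 + 3 * β) * (3 / 4 : ℝ) ^ γ ≤ 1) (hDγ : D ^ γ ≤ 2)
    (hJ : Fintype.card E < 2 ^ J) (A : Finset V) (hD : 2 * A.card ≤ D) (x : V) (hx : x ∈ A)
    (g : V → ℝ) (hg : ∀ u ∈ A, G.Reach G.len (G.inner A) x u (g u)) (ρ : ℝ)
    (hgρ : ∀ u ∈ A, g u ≤ ρ) :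
    G.HasTree γ (6 * (3 + 4 * J / β)) (Fintype.card E / β) A x g ρ := by
  induction hn : A.card using Nat.strong_induction_on generalizing A x g ρ with
  | _ n ih =>
  have hlen : ∀ e, 0 ≤ G.len e := fun e => (G.len_pos e).le
  have hκ : 1 ≤ 3 + 4 * J / β := by
    have : 0 ≤ 4 * J / β := by positivity
    linarith
  have hQ : 0 ≤ 6 * (3 + 4 * J / β) := by linarith
  have hρ0 : 0 ≤ ρ := ((hg x hx).nonneg hlen).trans (hgρ x hx)
  by_cases hA : A = {x}
  · subst hA
    exact hasTree_singleton hγ hQ ((hg x hx).nonneg hlen) hρ0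
  set d : V → ℝ := G.dst (ρ + 1) G.len (G.inner A) x with hd
  have hdg : ∀ u ∈ A, d u ≤ g u := fun u hu => dst_le_of_reach (hg u hu)
  have hdr : ∀ u ∈ A, G.Reach G.len (G.inner A) x u (d u) := fun u hu =>
    reach_dst (by have := hdg u hu; have := hgρ u hu; linarith)
  obtain ⟨z, hz, hzmax⟩ := A.exists_max_image d ⟨x, hx⟩
  have hpos : 0 < d z := by
    obtain ⟨u, hu, hux⟩ : ∃ u ∈ A, u ≠ x := by
      by_contra! h
      exact hA (Finset.eq_singleton_iff_unique_mem.mpr ⟨hx, h⟩)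
    obtain ⟨F, hF, hj, hs⟩ := hdr u hu
    obtain ⟨e, he, -⟩ := hj.exists_last hux
    have := Finset.sum_pos (fun e _ => G.len_pos e) ⟨e, he⟩
    have := hzmax u hu
    linarith
  have hm : (0 : ℝ) < Fintype.card E := by exact_mod_cast hE
  have hτ : 0 < β * d z / Fintype.card E := by positivity
  obtain ⟨q, f, r, hr, hr', hf, hqx, hqA, hqq, hne, hroot, hcone, hcut, hsum⟩ :=
    exists_star (τ := β * d z / Fintype.card E) hpos hβ hβ' (mul_div_cancel₀ _ hm.ne').le hτ hJ
      hdr hzmax ⟨z, hz, fun h => by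
        have : d z ≤ 3 / 4 * d z := dst_le_of_reach h
        linarith⟩
  refine HasTree.mono hγ hQ hpos.le hdg ((hdg z hz).trans (hgρ z hz)) ?_
  refine hasTree_of_star hβ hβ' hγ hγβ hD hDγ hpos hx hτ (le_of_eq ?_) hκ le_rfl hr hr' hzmax hf
    hqx hqA hqq hne (fun u hu h => (hcone u hu h).2.2) hcut hsum fun v hv => ?_
  · field_simp
  have hβρ : 0 < β * d z := by positivity
  obtain ⟨w, hw, rfl⟩ := Finset.mem_image.mp hv
  have hcard : (A.filter fun u => q u = q w).card < A.card := by
    refine Finset.card_lt_card (Finset.filter_ssubset.mpr ?_)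
    by_cases h : q w = x
    · rw [h]
      exact hne
    · exact ⟨x, hx, by rw [hqx]; exact Ne.symm h⟩
  have hD' : 2 * ((A.filter fun u => q u = q w).card : ℝ) ≤ D := by
    have : ((A.filter fun u => q u = q w).card : ℝ) ≤ A.card := by exact_mod_cast hcard.le
    linarith
  refine ih _ (hn ▸ hcard) _ hD' _ ?_ _ ?_ _ ?_ rfl
  · rw [Finset.mem_filter]
    refine ⟨?_, hqq w hw⟩
    rcases hqA w hw with h | h
    · rwa [h]
    · exact h
  · intro u hu
    rw [Finset.mem_filter] at hu
    split_ifs with h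
    · have := (hroot u hu.1 (hu.2.trans h)).2
      rw [h]
      exact this
    · have := (hcone u hu.1 (by rwa [hu.2])).2.1
      rw [hu.2] at this
      exact this
  · intro u hu
    rw [Finset.mem_filter] at hu
    split_ifs with h
    · have := (hroot u hu.1 (hu.2.trans h)).1
      linarith
    · have h1 := (hcone u hu.1 (by rwa [hu.2])).1
      rw [hu.2] at h1
      have h2 := (hf u hu.1).2
      have h3 := hzmax u hu.1
      linarith

end Assembly

section SpanningTree

open Real

variable {V E : Type} {G : WGraph V E}

lemma Walk.length_nonneg {u v : V} (p : G.Walk u v) : 0 ≤ p.length := by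
  induction p with
  | nil v => exact le_rfl
  | cons u v x e h p ih => exact add_nonneg (G.len_pos e).le ih

lemma Walk.reach [Fintype E] {u v : V} (p : G.Walk u v) :
    G.Reach G.len Finset.univ u v p.length := by
  induction p with
  | nil v => exact Reach.refl le_rfl
  | cons u v x e h p ih =>
    exact (Reach.of_link (Finset.mem_univ e) h).trans (fun e => (G.len_pos e).le) ih

lemma dist_nonneg (u v : V) : 0 ≤ G.dist u v := by
  refine Real.sInf_nonneg ?_
  rintro l ⟨p, rfl⟩
  exact p.length_nonneg

lemma Walk.dist_le {u v : V} (p : G.Walk u v) : G.dist u v ≤ p.length :=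
  csInf_le ⟨0, by rintro l ⟨p, rfl⟩; exact p.length_nonneg⟩ ⟨p, rfl⟩

lemma radius_le {x : V} {r : ℝ} (h : ∀ v, G.dist x v ≤ r) : G.radius x ≤ r :=
  csInf_le ⟨0, fun _ hr => (G.dist_nonneg x x).trans (hr x)⟩ h

lemma dist_le_radius [Finite V] (x v : V) : G.dist x v ≤ G.radius x := by
  obtain ⟨r, hr⟩ := (Set.finite_range (G.dist x)).bddAbove
  exact le_csInf ⟨r, fun v => hr ⟨v, rfl⟩⟩ fun _ hr => hr v

lemma Connected.reach_dist [Fintype E] (hG : G.Connected) (u v : V) :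
    G.Reach G.len Finset.univ u v (G.dist u v) := by
  have hlen : ∀ e, 0 ≤ G.len e := fun e => (G.len_pos e).le
  obtain ⟨p₀⟩ := hG u v
  have h1 : G.dst (p₀.length + 1) G.len Finset.univ u v ≤ p₀.length := dst_le_of_reach p₀.reach
  refine (reach_dst (h1.trans_lt (lt_add_one _))).mono subset_rfl (le_csInf ⟨_, p₀, rfl⟩ ?_)
  rintro l ⟨p, rfl⟩
  exact dst_le_of_reach p.reach

lemma Reach.exists_walk {T : Finset E} {u v : V} {r : ℝ} (h : G.Reach G.len T u v r) :
    ∃ p : (G.restrictE (T : Set E)).Walk u v, p.length ≤ r := by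
  obtain ⟨F, hF, hj, hs⟩ := h
  induction hn : F.card generalizing F u r with
  | zero =>
    have huv : u = v := by
      by_contra huv
      obtain ⟨e, he, -⟩ := hj.symm.exists_last huv
      rw [Finset.card_eq_zero.mp hn] at he
      simp at he
    subst huv
    rw [Finset.card_eq_zero.mp hn, Finset.sum_empty] at hs
    exact ⟨.nil u, hs⟩
  | succ n ih =>
    by_cases huv : u = v
    · subst huv
      exact ⟨.nil u, (Finset.sum_nonneg fun e _ => (G.len_pos e).le).trans hs⟩
    · obtain ⟨e, he, a, hl, hj'⟩ := hj.symm.exists_last huv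
      obtain ⟨p, hp⟩ := ih (F.erase e) ((Finset.erase_subset _ _).trans hF) hj'.symm le_rfl
        (by rw [Finset.card_erase_of_mem he, hn]; rfl)
      refine ⟨Walk.cons (G := G.restrictE (T : Set E)) u a v ⟨e, hF he⟩ hl.symm p, ?_⟩
      rw [← Finset.add_sum_erase F G.len he] at hs
      change G.len e + p.length ≤ r
      linarith

lemma Reach.dist_le {T : Finset E} {u v : V} {r : ℝ} (h : G.Reach G.len T u v r) :
    (G.restrictE (T : Set E)).dist u v ≤ r := by
  obtain ⟨p, hp⟩ := h.exists_walk
  exact p.dist_le.trans hp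

lemma card_le_of_joins [Fintype V] {F : Finset E} {x : V} (h : ∀ u, G.Joins F x u) :
    Fintype.card V ≤ F.card + 1 := by
  set S : Finset (Sym2 V) := F.image fun e => s((G.ends e).1, (G.ends e).2) with hS
  set H := SimpleGraph.fromEdgeSet (S : Set (Sym2 V)) with hH
  have hreach : ∀ u, H.Reachable x u := by
    intro u
    induction h u with
    | refl => exact SimpleGraph.Reachable.refl _
    | @tail b c _ hbc ih =>
      obtain ⟨e, he, hl⟩ := hbc
      by_cases hbc : b = c
      · rwa [← hbc]
      · refine ih.trans (SimpleGraph.Adj.reachable ?_)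
        rw [hH, SimpleGraph.fromEdgeSet_adj]
        refine ⟨Finset.mem_coe.mpr (Finset.mem_image.mpr ⟨e, he, ?_⟩), hbc⟩
        rcases hl with hl | hl <;> rw [hl]
        exact Sym2.eq_swap
  have hconn : H.Connected := by
    have : Nonempty V := ⟨x⟩
    exact ⟨fun u v => (hreach u).symm.trans (hreach v)⟩
  have h1 := hconn.card_vert_le_card_edgeSet_add_one
  have h2 : Nat.card H.edgeSet ≤ F.card := by
    refine le_trans ?_ (Finset.card_image_le (s := F)
      (f := fun e => s((G.ends e).1, (G.ends e).2)))
    rw [← hS, ← Set.ncard_coe_finset, Nat.card_coe_set_eq]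
    refine Set.ncard_le_ncard ?_
    rw [hH, SimpleGraph.edgeSet_fromEdgeSet]
    exact Set.sdiff_subset
  rw [Nat.card_eq_fintype_card] at h1
  omega

/-- A spanning tree of small radius and stretch, with the dependence on the decomposition
parameter `β` made explicit. -/
lemma Connected.exists_spanningTree [Fintype V] [Fintype E] (hG : G.Connected)
    (hE : 0 < Fintype.card E) {β γ : ℝ} {J : ℕ} (hβ : 0 < β) (hβ' : β ≤ 1 / 24) (hγ : 0 ≤ γ)
    (hγβ : (1 + 3 * β) * (3 / 4 : ℝ) ^ γ ≤ 1)
    (hDγ : (4 * ((Fintype.card E : ℝ) + 1)) ^ γ = √(exp 1)) (hJ : Fintype.card E < 2 ^ J)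
    (x₀ : V) :
    ∃ T : Finset E, G.IsSpanningTree T ∧
      (G.restrictE (T : Set E)).radius x₀ ≤ 2 * √(exp 1) * G.radius x₀ ∧
      G.avestretch T ≤
        6 * (3 + 4 * J / β) * (1 + 4 * log (4 / 3 * (Fintype.card E / β))) := by
  have hlen : ∀ e, 0 ≤ G.len e := fun e => (G.len_pos e).le
  have hm : (1 : ℝ) ≤ Fintype.card E := by exact_mod_cast hE
  have hsqrt : √(exp 1) ≤ 2 := by
    rw [Real.sqrt_le_left (by norm_num)]
    have := exp_one_lt_d9
    norm_num at this ⊢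
    linarith
  have hsqrt1 : 1 ≤ √(exp 1) := Real.one_le_sqrt.mpr (one_le_exp zero_le_one)
  have hinner : G.inner (Finset.univ : Finset V) = Finset.univ := by
    ext e
    simp [mem_inner]
  have hrad : ∀ u, G.Reach G.len Finset.univ x₀ u (G.radius x₀) := fun u =>
    (hG.reach_dist x₀ u).mono subset_rfl (dist_le_radius x₀ u)
  have hρ : 0 ≤ G.radius x₀ := (hrad x₀).nonneg hlen
  have hcardV : (Fintype.card V : ℝ) ≤ Fintype.card E + 1 := by
    have := card_le_of_joins (x := x₀) fun u => by
      obtain ⟨F, hF, hj, -⟩ := hrad u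
      exact hj.mono hF
    rw [Finset.card_univ] at this
    exact_mod_cast this
  obtain ⟨T, s, hTc, -, hTd, hTs, hsum⟩ := hasTree (D := 4 * ((Fintype.card E : ℝ) + 1))
    hE hβ hβ' hγ hγβ (hDγ.le.trans hsqrt) hJ Finset.univ
    (by rw [Finset.card_univ]; linarith) x₀ (Finset.mem_univ _) (fun _ => G.radius x₀)
    (fun u _ => by rw [hinner]; exact hrad u) (G.radius x₀) fun _ _ => le_rfl
  have hdist : ∀ u, G.Reach G.len T x₀ u (2 * √(exp 1) * G.radius x₀) := by
    intro u
    rcases hρ.eq_or_lt with h0 | hpos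
    · obtain ⟨F, -, hj, hs⟩ := hrad u
      have hu : u = x₀ := by
        by_contra hu
        obtain ⟨e, he, -⟩ := hj.exists_last hu
        have := Finset.sum_pos (fun e _ => G.len_pos e) ⟨e, he⟩
        linarith
      rw [hu]
      exact Reach.refl (by positivity)
    · have hD : (0 : ℝ) < 4 * (Fintype.card E + 1) := by linarith
      refine (hTd (G.radius x₀ / (4 * (Fintype.card E + 1))) (by positivity) u
        (Finset.mem_univ u)).mono subset_rfl ?_
      have h1 : excess γ (G.radius x₀ / (4 * (Fintype.card E + 1))) (G.radius x₀) =
          G.radius x₀ * (√(exp 1) - 1) := by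
        unfold excess
        rw [div_div_cancel₀ hpos.ne', max_eq_right (by linarith), hDγ]
      have h2 : 2 * (G.radius x₀ / (4 * (Fintype.card E + 1))) *
          (Finset.univ : Finset V).card ≤ G.radius x₀ := by
        rw [Finset.card_univ, show 2 * (G.radius x₀ / (4 * ((Fintype.card E : ℝ) + 1))) *
          Fintype.card V = G.radius x₀ * (2 * Fintype.card V) / (4 * (Fintype.card E + 1)) by
          ring, div_le_iff₀ hD]
        gcongr
        linarith
      have h3 : G.radius x₀ * 1 ≤ G.radius x₀ * √(exp 1) := by gcongr
      linarith
  refine ⟨T, ⟨fun u v => ?_, ?_⟩, radius_le fun u => (hdist u).dist_le, ?_⟩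
  · obtain ⟨p, -⟩ := ((hdist u).symm.trans hlen (hdist v)).exists_walk
    exact ⟨p⟩
  · rw [Finset.card_univ] at hTc
    refine le_antisymm hTc (card_le_of_joins (G := G) (x := x₀) fun u => ?_)
    obtain ⟨F, hF, hj, -⟩ := hdist u
    exact hj.mono hF
  · have hY : 1 ≤ (Fintype.card E : ℝ) / β := by
      rw [one_le_div hβ]
      linarith
    have hQ : 0 ≤ 6 * (3 + 4 * J / β) := by positivity
    rw [hinner] at hsum hTs
    rw [avestretch, div_le_iff₀ (by linarith)]
    calc ∑ e, G.stretch T e ≤ ∑ e, s e / G.len e := by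
          refine Finset.sum_le_sum fun e he => ?_
          have := G.len_pos e
          unfold stretch
          gcongr
          exact (hTs e he).dist_le
      _ ≤ 6 * (3 + 4 * J / β) * ∑ _e : E, (1 + 4 * log (4 / 3 * (Fintype.card E / β))) :=
          hsum.trans (mul_le_mul_of_nonneg_left
            (Finset.sum_le_sum fun e _ => potential_le hY _) hQ)
      _ = _ := by
          rw [Finset.sum_const, Finset.card_univ, nsmul_eq_mul]
          ring

end SpanningTree

end WGraph

open Real in
lemma one_add_mul_rpow_le_one {β : ℝ} (hβ : 0 ≤ β) :
    (1 + 3 * β) * (3 / 4 : ℝ) ^ (12 * β) ≤ 1 := by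
  have h1 : log (3 / 4) ≤ -(1 / 4) := by
    have := log_le_sub_one_of_pos (show (0 : ℝ) < 3 / 4 by norm_num)
    norm_num at this ⊢
    linarith
  rw [rpow_def_of_pos (by norm_num)]
  calc (1 + 3 * β) * exp (log (3 / 4) * (12 * β)) ≤ exp (3 * β) * exp (-(3 * β)) := by
        gcongr
        · linarith [add_one_le_exp (3 * β)]
        · nlinarith
    _ = 1 := by rw [← exp_add]; simp

open Real in
lemma log_mul_natCast_le {m : ℕ} (hm : 2 ≤ m) (k : ℕ) :
    log (2 ^ k * m) ≤ (k + 1) * log m := by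
  have hm' : (2 : ℝ) ≤ m := by exact_mod_cast hm
  have := log_le_log two_pos hm'
  rw [log_mul (by positivity) (by positivity), log_pow]
  nlinarith [k.cast_nonneg (α := ℝ)]

open Real in
lemma stretch_bound_le {m : ℕ} (hm : 2 ≤ m) {Λ : ℝ} (hΛ : Λ = log (4 * (m + 1))) :
    6 * (3 + 4 * ((Nat.log 2 m + 1 : ℕ) : ℝ) / (1 / (24 * Λ))) *
      (1 + 4 * log (4 / 3 * (m / (1 / (24 * Λ))))) ≤ 390096 * log m ^ 3 := by
  have hm' : (2 : ℝ) ≤ m := by exact_mod_cast hm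
  have hlog2 : 1 / 2 ≤ log 2 := by linarith [log_two_gt_d9]
  have hL : log 2 ≤ log m := log_le_log two_pos hm'
  set L := log m with hLdef
  have hL0 : 0 ≤ L := by linarith
  have hΛ0 : 0 < Λ := by
    rw [hΛ]
    exact log_pos (by linarith)
  have hΛL : Λ ≤ 4 * L := by
    rw [hΛ]
    refine (log_le_log (by linarith) ?_).trans
      ((log_mul_natCast_le hm 3).trans (by norm_num [← hLdef]))
    linarith
  have hΛm : Λ ≤ 6 * m := by
    rw [hΛ]
    refine (log_le_self (by linarith)).trans ?_
    linarith
  have hJ : ((Nat.log 2 m + 1 : ℕ) : ℝ) ≤ 4 * L := by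
    have h1 : (2 : ℝ) ^ Nat.log 2 m ≤ m := by
      exact_mod_cast Nat.pow_log_le_self 2 (by omega)
    have h2 := log_le_log (by positivity) h1
    rw [log_pow, ← hLdef] at h2
    have h3 := mul_le_mul_of_nonneg_left hlog2 (Nat.log 2 m).cast_nonneg
    push_cast
    linarith
  have hQ : 6 * (3 + 4 * ((Nat.log 2 m + 1 : ℕ) : ℝ) / (1 / (24 * Λ))) ≤ 9288 * L ^ 2 := by
    have h1 := mul_le_mul hJ hΛL hΛ0.le (by linarith)
    have h2 : 4 * ((Nat.log 2 m + 1 : ℕ) : ℝ) / (1 / (24 * Λ)) =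
        96 * (((Nat.log 2 m + 1 : ℕ) : ℝ) * Λ) := by
      rw [div_div_eq_mul_div]
      ring
    rw [h2]
    nlinarith
  have hP : 1 + 4 * log (4 / 3 * (m / (1 / (24 * Λ)))) ≤ 42 * L := by
    have h1 : 4 / 3 * (m / (1 / (24 * Λ))) ≤ 2 ^ 8 * (m : ℝ) * m := by
      rw [div_div_eq_mul_div]
      nlinarith
    have h2 : log (2 ^ 8 * (m : ℝ) * m) ≤ 10 * L := by
      rw [log_mul (by positivity) (by positivity)]
      have := log_mul_natCast_le hm 8
      push_cast at this
      linarith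
    have h3 := (log_le_log (by positivity) h1).trans h2
    linarith
  calc _ ≤ 9288 * L ^ 2 * (42 * L) := by
        refine (mul_le_mul_of_nonneg_left hP (by positivity)).trans ?_
        exact mul_le_mul_of_nonneg_right hQ (by positivity)
    _ = 390096 * L ^ 3 := by ring

/-- Low-stretch spanning trees for weighted connected graphs with
`m ≥ 2` edges: `radius(T,x0) ≤ 2√e · radius(G,x0)` and
`avestretch(T,E) ≤ C · (log m)³`. -/
theorem lowStretchTree_logCubed :
    ∃ C : ℝ, ∀ (V E : Type) [Fintype V] [Fintype E] (G : WGraph V E),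
      G.Connected → 2 ≤ Fintype.card E → ∀ x0 : V,
        ∃ T : Finset E, G.IsSpanningTree T ∧
          (G.restrictE (T : Set E)).radius x0 ≤
            2 * Real.sqrt (Real.exp 1) * G.radius x0 ∧
          G.avestretch T ≤ C * Real.log (Fintype.card E) ^ 3 := by
  refine ⟨390096, fun V E _ _ G hG hm x₀ => ?_⟩
  set m := Fintype.card E with hmE
  have hm' : (2 : ℝ) ≤ m := by exact_mod_cast hm
  set Λ := Real.log (4 * ((m : ℝ) + 1)) with hΛ
  have hΛ1 : 1 ≤ Λ := by
    rw [hΛ, Real.le_log_iff_exp_le (by linarith)]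
    linarith [Real.exp_one_lt_d9]
  obtain ⟨T, hT, hrad, hstretch⟩ := hG.exists_spanningTree (by omega)
    (β := 1 / (24 * Λ)) (γ := 12 * (1 / (24 * Λ))) (J := Nat.log 2 m + 1) (by positivity)
    (one_div_le_one_div_of_le (by norm_num) (by linarith)) (by positivity)
    (one_add_mul_rpow_le_one (by positivity)) (by
      rw [Real.rpow_def_of_pos (by positivity), ← hΛ, ← Real.exp_half]
      congr 1
      field_simp
      norm_num)
    (Nat.lt_pow_succ_log_self one_lt_two _) x₀
  exact ⟨T, hT, hrad, hstretch.trans (stretch_bound_le hm hΛ)⟩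
end

section
/- Let G = (V,E,w) be a weighted connected graph with m = |E| edges and let L = {L_r} be a concentric system in G. For every two reals 0 ≤ λ < λ' there exists a real r ∈ [λ, λ') such that cost(∂L_r) ≤ ((vol(L_r) + τ)/(λ' − λ)) · max[1, log_2((m + τ)/(vol(E(L_λ)) + τ))], where τ = 1 if vol(E(L_λ)) = 0 and τ = 0 otherwise. -/
open scoped Classical

open MeasureTheory

/-- An integral form of the lower Grönwall inequality. -/
theorem mul_exp_le_add_integral_of_mul_le {f : ℝ → ℝ} {a b k c : ℝ} (hab : a ≤ b) (hk : 0 ≤ k)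
    (hf : IntervalIntegrable f volume a b)
    (h : ∀ r, a ≤ r → r < b → k * (c + ∫ s in a..r, f s) ≤ f r) :
    c * Real.exp (k * (b - a)) ≤ c + ∫ s in a..b, f s := by
  set M : ℝ → ℝ := fun r => c + ∫ s in a..r, f s with hM
  have hMc : ContinuousOn M (Set.Icc a b) := by
    have := intervalIntegral.continuousOn_primitive_interval (μ := volume) (f := f)
      (a := a) (b := b)
      (by rw [Set.uIcc_of_le hab]; exact (intervalIntegrable_iff_integrableOn_Icc_of_le hab).1 hf)
    rw [Set.uIcc_of_le hab] at this
    exact continuousOn_const.add this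
  have hsub : ∀ r ∈ Set.Icc a b, IntervalIntegrable M volume a r := fun r hr =>
    (hMc.mono (by rw [Set.uIcc_of_le hr.1]; exact Set.Icc_subset_Icc_right hr.2)).intervalIntegrable
  set P : ℝ → ℝ := fun r => c + k * ∫ s in a..r, M s with hP
  have hPM : ∀ r ∈ Set.Icc a b, P r ≤ M r := by
    intro r hr
    simp only [hP, hM]
    rw [← intervalIntegral.integral_const_mul]
    refine add_le_add le_rfl ?_
    refine intervalIntegral.integral_mono_on_of_le_Ioo hr.1 ((hsub r hr).const_mul k)
      (hf.mono_set (by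
        rw [Set.uIcc_of_le hr.1, Set.uIcc_of_le hab]; exact Set.Icc_subset_Icc_right hr.2)) ?_
    intro s hs
    exact h s hs.1.le (hs.2.trans_le hr.2)
  have hPc : ContinuousOn P (Set.Icc a b) := by
    have := intervalIntegral.continuousOn_primitive_interval (μ := volume) (f := M)
      (a := a) (b := b)
      (by rw [Set.uIcc_of_le hab]; exact hMc.integrableOn_Icc)
    rw [Set.uIcc_of_le hab] at this
    exact continuousOn_const.add (continuousOn_const.mul this)
  have hPd : ∀ r ∈ Set.Ioo a b, HasDerivAt P (k * M r) r := by
    intro r hr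
    have hnhds : Set.Icc a b ∈ nhds r := Icc_mem_nhds hr.1 hr.2
    have := intervalIntegral.integral_hasDerivAt_right (hsub r ⟨hr.1.le, hr.2.le⟩)
      (hMc.stronglyMeasurableAtFilter_nhdsWithin measurableSet_Icc r |>.filter_mono
        (by rw [nhdsWithin_eq_nhds.2 hnhds]))
      (hMc.continuousAt hnhds)
    exact (this.const_mul k).const_add c
  have hmono : MonotoneOn (fun r => P r * Real.exp (-(k * (r - a)))) (Set.Icc a b) := by
    have hd : ∀ r ∈ Set.Ioo a b, HasDerivAt (fun r => P r * Real.exp (-(k * (r - a))))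
        (k * M r * Real.exp (-(k * (r - a))) +
          P r * (Real.exp (-(k * (r - a))) * (-(k * 1)))) r := by
      intro r hr
      exact (hPd r hr).mul ((((hasDerivAt_id r).sub_const a).const_mul k).neg.exp)
    refine monotoneOn_of_deriv_nonneg (convex_Icc a b) (hPc.mul (by fun_prop)) ?_ ?_
    · rw [interior_Icc]
      exact fun r hr => (hd r hr).differentiableAt.differentiableWithinAt
    · rw [interior_Icc]
      intro r hr
      rw [(hd r hr).deriv]
      have h1 := hPM r ⟨hr.1.le, hr.2.le⟩
      have h2 := mul_nonneg (mul_nonneg hk (sub_nonneg.2 h1)) (Real.exp_pos (-(k * (r - a)))).le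
      linarith
  have hfin := hmono ⟨le_rfl, hab⟩ ⟨hab, le_rfl⟩ hab
  have hPa : P a = c := by simp [hP]
  simp only [hPa, sub_self, mul_zero, neg_zero, Real.exp_zero, mul_one] at hfin
  refine le_trans ?_ (hPM b ⟨hab, le_rfl⟩)
  have h3 := mul_le_mul_of_nonneg_right hfin (Real.exp_pos (k * (b - a))).le
  rwa [mul_assoc, ← Real.exp_add, neg_add_cancel, Real.exp_zero, mul_one] at h3

namespace WGraph

variable {V E : Type} {G : WGraph V E} {L : ℝ → Set V}

/-- The radii, at least `a`, at which `e` is a boundary edge of the concentric system `L`. -/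
def crossing (G : WGraph V E) (L : ℝ → Set V) (a : ℝ) (e : E) : Set ℝ :=
  {s | a ≤ s ∧ e ∈ G.bdry (L s)}

theorem IsConcentric.mono_le (hL : G.IsConcentric L) {r r' : ℝ} (h0 : 0 ≤ r) (h : r ≤ r') :
    L r ⊆ L r' := by
  rcases h.eq_or_lt with rfl | h
  · exact subset_rfl
  · exact hL.mono r r' h0 h

theorem IsConcentric.ordConnected_crossing (hL : G.IsConcentric L) {a : ℝ} (ha : 0 ≤ a) (e : E) :
    (G.crossing L a e).OrdConnected := by
  refine ⟨fun s hs t ht x hx => ⟨hs.1.trans hx.1, ?_⟩⟩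
  have h1 := hL.mono_le (ha.trans hs.1) hx.1
  have h2 := hL.mono_le (ha.trans (hs.1.trans hx.1)) hx.2
  obtain ⟨-, hs⟩ := hs
  obtain ⟨-, ht⟩ := ht
  simp only [bdry, Set.mem_ofPred_eq] at *
  have := @h1 (G.ends e).1
  have := @h1 (G.ends e).2
  have := @h2 (G.ends e).1
  have := @h2 (G.ends e).2
  tauto

theorem IsConcentric.crossing_le_add_len (hL : G.IsConcentric L) {a : ℝ} (ha : 0 ≤ a) {e : E}
    {s t : ℝ} (hs : s ∈ G.crossing L a e) (ht : t ∈ G.crossing L a e) : t ≤ s + G.len e := by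
  by_contra! hlt
  have hlen : 0 < G.len e := one_div_pos.2 (G.w_pos e)
  have hs0 : 0 ≤ s := ha.trans hs.1
  have h1 := hL.mono_le hs0 (by linarith : s ≤ t)
  have h2 := hL.mono_le (by linarith : 0 ≤ s + G.len e) hlt.le
  have h3 := hL.closed s hs0 e
  obtain ⟨-, hs⟩ := hs
  obtain ⟨-, ht⟩ := ht
  simp only [bdry, Set.mem_ofPred_eq] at *
  have := @h1 (G.ends e).1
  have := @h1 (G.ends e).2
  have := @h2 (G.ends e).1
  have := @h2 (G.ends e).2
  tauto

theorem IsConcentric.w_mul_volume_crossing_le (hL : G.IsConcentric L) {a : ℝ} (ha : 0 ≤ a) (e : E)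
    (S : Set ℝ) : G.w e * volume.real (G.crossing L a e ∩ S) ≤ 1 := by
  have hw := G.w_pos e
  have hlen : 0 ≤ G.len e := (one_div_pos.2 hw).le
  have hvol : volume (G.crossing L a e ∩ S) ≤ ENNReal.ofReal (G.len e) := by
    refine (measure_mono Set.inter_subset_left).trans ((Real.volume_le_diam _).trans ?_)
    refine Metric.ediam_le fun s hs t ht => ?_
    rw [edist_dist]
    refine ENNReal.ofReal_le_ofReal (abs_sub_le_iff.2 ⟨?_, ?_⟩)
    · linarith [hL.crossing_le_add_len ha ht hs]
    · linarith [hL.crossing_le_add_len ha hs ht]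
  have := ENNReal.toReal_le_of_le_ofReal hlen hvol
  calc G.w e * volume.real (G.crossing L a e ∩ S) ≤ G.w e * G.len e :=
        mul_le_mul_of_nonneg_left this hw.le
    _ = 1 := by rw [len]; field_simp

theorem cost_bdry_eq_sum_indicator_crossing [Fintype E] {a s : ℝ} (has : a ≤ s) :
    G.cost (G.bdry (L s)) = ∑ e, (G.crossing L a e).indicator (fun _ => G.w e) s := by
  refine Finset.sum_congr rfl fun e _ => ?_
  simp [Set.indicator_apply, crossing, has]

theorem IsConcentric.integrableOn_indicator_crossing (hL : G.IsConcentric L) {a : ℝ} (ha : 0 ≤ a)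
    (e : E) (r : ℝ) :
    IntegrableOn ((G.crossing L a e).indicator fun _ => G.w e) (Set.Ioc a r) :=
  (integrableOn_const (by simp)).indicator (hL.ordConnected_crossing ha e).measurableSet

/-- The edges inside `L a`, together with the boundary cost accumulated from `a` to `r`, are
bounded by the volume of `L r`. -/
theorem IsConcentric.ncard_add_integral_le_volV [Fintype E] (hL : G.IsConcentric L) {a r : ℝ}
    (ha : 0 ≤ a) (har : a ≤ r) :
    ((G.edgesIn (L a)).ncard : ℝ) +
      ∫ s in a..r, ∑ e, (G.crossing L a e).indicator (fun _ => G.w e) s ≤ G.volV (L r) := by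
  have hcard : ∀ S : Set E, (S.ncard : ℝ) = ∑ e, S.indicator (fun _ => (1 : ℝ)) e := by
    intro S
    simp only [Set.indicator_apply, Finset.sum_boole]
    rw [Set.ncard_eq_toFinset_card', Set.filter_mem_univ_eq_toFinset]
  rw [intervalIntegral.integral_of_le har,
    integral_finsetSum _ fun e _ => hL.integrableOn_indicator_crossing ha e r, volV, hcard, hcard,
    ← Finset.sum_add_distrib]
  refine Finset.sum_le_sum fun e _ => ?_
  have hmeas := (hL.ordConnected_crossing ha e).measurableSet
  rw [integral_indicator_const _ hmeas, measureReal_restrict_apply hmeas, smul_eq_mul, mul_comm]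
  have hle := hL.w_mul_volume_crossing_le ha e (Set.Ioc a r)
  have hmono := hL.mono_le ha har
  by_cases hin : e ∈ G.edgesIn (L a)
  · have hempty : G.crossing L a e ∩ Set.Ioc a r = ∅ := by
      refine Set.eq_empty_of_forall_notMem fun s hs => ?_
      have hm := hL.mono_le ha hs.1.1
      have h1 := hm hin.1
      have h2 := hm hin.2
      have h3 := hs.1.2
      simp only [bdry, Set.mem_ofPred_eq] at h3
      tauto
    have hout : e ∈ {e : E | (G.ends e).1 ∈ L r ∨ (G.ends e).2 ∈ L r} := Or.inl (hmono hin.1)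
    simp [hempty, Set.indicator_of_mem hin, Set.indicator_of_mem hout]
  · rw [Set.indicator_of_notMem hin, zero_add]
    by_cases hout : e ∈ {e : E | (G.ends e).1 ∈ L r ∨ (G.ends e).2 ∈ L r}
    · rwa [Set.indicator_of_mem hout]
    · have hempty : G.crossing L a e ∩ Set.Ioc a r = ∅ := by
        refine Set.eq_empty_of_forall_notMem fun s hs => hout ?_
        have hm := hL.mono_le (ha.trans hs.1.1) hs.2.2
        exact hs.1.2.elim (fun h => Or.inl (hm h.1)) (fun h => Or.inr (hm h.2))
      simp [hempty, Set.indicator_of_notMem hout]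

end WGraph

theorem Real.log_lt_max_one_logb_two (x : ℝ) : Real.log x < max 1 (Real.logb 2 x) := by
  rcases lt_or_ge (Real.log x) 1 with h | h
  · exact h.trans_le (le_max_left _ _)
  · refine lt_of_lt_of_le ?_ (le_max_right _ _)
    have h2 : 0 < Real.log 2 := Real.log_pos one_lt_two
    have h3 := Real.log_two_lt_d9
    rw [Real.logb, lt_div_iff₀ h2]
    nlinarith


/-- Concentric system cutting: for `0 ≤ λ < λ'` there is
`r ∈ [λ, λ')` with
`cost(∂L_r) ≤ ((vol(L_r)+τ)/(λ'−λ)) · max(1, log₂((m+τ)/(vol(E(L_λ))+τ)))`. -/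
theorem concentric_system_cutting (V E : Type) [Fintype V] [Fintype E] (G : WGraph V E)
    (hG : G.Connected) (L : ℝ → Set V) (hL : G.IsConcentric L)
    (lam lam' : ℝ) (h0 : 0 ≤ lam) (hlt : lam < lam')
    (τ : ℝ) (hτ : τ = if (G.edgesIn (L lam)).ncard = 0 then 1 else 0) :
    ∃ r : ℝ, lam ≤ r ∧ r < lam' ∧
      G.cost (G.bdry (L r)) ≤
        ((G.volV (L r) : ℝ) + τ) / (lam' - lam) *
          max 1 (Real.logb 2
            (((Fintype.card E : ℝ) + τ) /
              (((G.edgesIn (L lam)).ncard : ℝ) + τ))) := by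
  have hτ0 : 0 ≤ τ := by rw [hτ]; split_ifs <;> norm_num
  set n : ℝ := ((G.edgesIn (L lam)).ncard : ℝ) with hn
  have hn0 : 0 < n + τ := by
    rw [hτ, hn]
    split_ifs with h
    · positivity
    · have : 0 < (G.edgesIn (L lam)).ncard := Nat.pos_of_ne_zero h
      positivity
  set x : ℝ := ((Fintype.card E : ℝ) + τ) / (n + τ) with hx
  set K : ℝ := max 1 (Real.logb 2 x)
  have hΔ : 0 < lam' - lam := sub_pos.2 hlt
  have hK0 : 0 < K := zero_lt_one.trans_le (le_max_left _ _)
  by_contra! hcon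
  have hvol : ∀ r, lam ≤ r → n + τ +
      ∫ s in lam..r, ∑ e, (G.crossing L lam e).indicator (fun _ => G.w e) s ≤
        G.volV (L r) + τ := fun r hr => by
    linarith [hL.ncard_add_integral_le_volV h0 hr]
  have hgrow := mul_exp_le_add_integral_of_mul_le (c := n + τ) (k := K / (lam' - lam)) hlt.le
    (by positivity)
    ((intervalIntegrable_iff_integrableOn_Ioc_of_le hlt.le).2
      (integrable_finsetSum _ fun e _ => hL.integrableOn_indicator_crossing h0 e lam'))
    (fun r hr hr' => by
      rw [← WGraph.cost_bdry_eq_sum_indicator_crossing hr]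
      refine le_trans ?_ (hcon r hr hr').le
      rw [div_mul_eq_mul_div, div_mul_eq_mul_div, mul_comm]
      have := hvol r hr
      gcongr)
  rw [div_mul_cancel₀ _ hΔ.ne'] at hgrow
  have hm : (G.volV (L lam') : ℝ) ≤ Fintype.card E := by
    rw [← Nat.card_eq_fintype_card]
    exact_mod_cast Set.ncard_le_card _
  have hexp : Real.exp K ≤ x := by
    rw [hx, le_div_iff₀ hn0]
    linarith [hvol lam' hlt.le]
  exact absurd ((Real.le_log_iff_exp_le ((Real.exp_pos K).trans_le hexp)).2 hexp)
    (not_le.2 (Real.log_lt_max_one_logb_two x))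
end

section
/- Let G = (V,E,w) be a weighted connected graph and let L = {L_r} be a concentric system in G. Let 0 ≤ λ < λ' be reals such that no vertex v ∈ V has |v|_L ∈ [λ, λ'). Then, setting r = (λ + λ')/2, every edge in ∂L_r has length greater than λ' − λ, and consequently cost(∂L_r) ≤ vol(L_r)/(λ' − λ). -/
open scoped Classical

namespace WGraph

/-- If `u ∈ L r`, `v ∉ L r` and `v` is reached from `u` by a step of length `d`,
then a gap of entry radii on `[a, b)` around `r` forces `b - a < d`. -/
theorem sub_lt_of_entry_gap {V : Type} {L : ℝ → Set V} {a b r d : ℝ} {u v : V}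
    (mono : ∀ r r' : ℝ, 0 ≤ r → r < r' → L r ⊆ L r')
    (hr : 0 ≤ r) (har : a ≤ r) (hrb : r < b) (hd : 0 ≤ d)
    (hgap : ∀ x : V, sInf {t : ℝ | 0 ≤ t ∧ x ∈ L t} ∉ Set.Ico a b)
    (hu : u ∈ L r) (hv : v ∉ L r)
    (step : ∀ t, 0 ≤ t → u ∈ L t → v ∈ L (t + d)) : b - a < d := by
  have bdd : ∀ x : V, BddBelow {t : ℝ | 0 ≤ t ∧ x ∈ L t} := fun x => ⟨0, fun t ht => ht.1⟩
  have hu_lt : sInf {t : ℝ | 0 ≤ t ∧ u ∈ L t} < a := by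
    by_contra! h
    exact hgap u ⟨h, (csInf_le (bdd u) ⟨hr, hu⟩).trans_lt hrb⟩
  have hu_ne : {t : ℝ | 0 ≤ t ∧ u ∈ L t}.Nonempty := ⟨r, hr, hu⟩
  obtain ⟨t, ⟨ht, hut⟩, hta⟩ := exists_lt_of_csInf_lt hu_ne hu_lt
  have hvt : t + d ∈ {t : ℝ | 0 ≤ t ∧ v ∈ L t} := ⟨add_nonneg ht hd, step t ht hut⟩
  have hv_ge : r ≤ sInf {t : ℝ | 0 ≤ t ∧ v ∈ L t} := by
    refine le_csInf ⟨_, hvt⟩ fun s hs => ?_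
    by_contra! h
    exact hv (mono s r hs.1 h hs.2)
  have hb : b ≤ sInf {t : ℝ | 0 ≤ t ∧ v ∈ L t} := by
    by_contra! h
    exact hgap v ⟨har.trans hv_ge, h⟩
  linarith [csInf_le (bdd v) hvt]

/-- If every boundary edge of `S` has length at least `c > 0`, then the boundary
costs at most `vol(S) / c`. -/
theorem cost_bdry_le_volV_div {V E : Type} [Fintype E] (G : WGraph V E) (S : Set V) {c : ℝ}
    (hc : 0 < c) (h : ∀ e ∈ G.bdry S, c ≤ G.len e) :
    G.cost (G.bdry S) ≤ (G.volV S : ℝ) / c := by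
  have hvol : (G.volV S : ℝ) / c =
      ∑ e : E, {e : E | (G.ends e).1 ∈ S ∨ (G.ends e).2 ∈ S}.indicator (fun _ => 1 / c) e := by
    rw [volV, Set.ncard_eq_toFinset_card', div_eq_mul_one_div, ← nsmul_eq_mul,
      ← Finset.sum_const, ← Finset.sum_indicator_subset _ (Finset.subset_univ _),
      Set.coe_toFinset]
  rw [hvol, cost]
  refine Finset.sum_le_sum fun e _ => ?_
  by_cases he : e ∈ G.bdry S
  · have hmem : e ∈ {e : E | (G.ends e).1 ∈ S ∨ (G.ends e).2 ∈ S} :=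
      he.imp And.left And.right
    rw [Set.indicator_of_mem he, Set.indicator_of_mem hmem]
    exact (le_one_div (G.w_pos e) hc).2 (h e he)
  · rw [Set.indicator_of_notMem he]
    exact Set.indicator_nonneg (fun _ _ => (one_div_pos.2 hc).le) e

end WGraph

/-- If no vertex enters the concentric system at a radius in
`[λ, λ')`, then with `r = (λ+λ')/2` every edge of `∂L_r` has length greater
than `λ' − λ` and `cost(∂L_r) ≤ vol(L_r)/(λ'−λ)`. -/
theorem concentric_gap (V E : Type) [Fintype V] [Fintype E] (G : WGraph V E)
    (hG : G.Connected) (L : ℝ → Set V) (hL : G.IsConcentric L)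
    (lam lam' : ℝ) (h0 : 0 ≤ lam) (hlt : lam < lam')
    (hgap : ∀ v : V, sInf {t : ℝ | 0 ≤ t ∧ v ∈ L t} ∉ Set.Ico lam lam') :
    (∀ e ∈ G.bdry (L ((lam + lam') / 2)), lam' - lam < G.len e) ∧
    G.cost (G.bdry (L ((lam + lam') / 2))) ≤
      (G.volV (L ((lam + lam') / 2)) : ℝ) / (lam' - lam) := by
  have hlen : ∀ e ∈ G.bdry (L ((lam + lam') / 2)), lam' - lam < G.len e := by
    intro e he
    have hd : 0 ≤ G.len e := (one_div_pos.2 (G.w_pos e)).le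
    rcases he with ⟨hin, hout⟩ | ⟨hout, hin⟩
    · exact WGraph.sub_lt_of_entry_gap hL.mono (by linarith) (by linarith) (by linarith) hd hgap
        hin hout fun t ht => (hL.closed t ht e).1
    · exact WGraph.sub_lt_of_entry_gap hL.mono (by linarith) (by linarith) (by linarith) hd hgap
        hin hout fun t ht => (hL.closed t ht e).2
  exact ⟨hlen, G.cost_bdry_le_volV_div _ (sub_pos.2 hlt) fun e he => (hlen e he).le⟩
end
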